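/- arXiv:math/0405178 — 3 statements merged into one kernel-verified Lean document; each statement's English description precedes it below -/
import Mathlib

section
/- Let n ≥ 2 and let φ be an automorphism of the free group FreeGroup (Fin n) of rank n. Then the periodic subgroup of φ equals the fixed subgroup of φ^{(6n−6)!}; that is, for every w ∈ FreeGroup (Fin n), if φ^k(w) = w for some integer k ≥ 1, then φ^{(6n−6)!}(w) = w. -/
namespace PerFix

/-- Functions on words; the free group acts on these. -/
abbrev Mod (n : ℕ) := List (Fin n) → ℤ

/-- Square-zero shift operator attached to the letter `i`. -/
def T {n : ℕ} (i : Fin n) : Module.End ℤ (Mod n) where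
  toFun f := fun L => match L with
    | [] => 0
    | j :: K => if j = i ∧ K.head? ≠ some i then f K else 0
  map_add' f g := by
    funext L
    cases L with
    | nil => simp
    | cons j K => simp only [Pi.add_apply]; split_ifs <;> simp
  map_smul' c f := by
    funext L
    cases L with
    | nil => simp
    | cons j K => simp only [Pi.smul_apply]; split_ifs <;> simp

lemma T_nil {n : ℕ} (i : Fin n) (f : Mod n) : T i f [] = 0 := rfl

lemma T_cons {n : ℕ} (i j : Fin n) (K : List (Fin n)) (f : Mod n) :
    T i f (j :: K) = if j = i ∧ K.head? ≠ some i then f K else 0 := rfl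

lemma T_of_head_ne {n : ℕ} (i : Fin n) (K : List (Fin n)) (f : Mod n) (h : K.head? ≠ some i) :
    T i f K = 0 := by
  cases K with
  | nil => rfl
  | cons j K =>
    rw [T_cons, if_neg]
    rintro ⟨rfl, -⟩
    simp at h

lemma T_sq {n : ℕ} (i : Fin n) : T i * T i = 0 := by
  ext f L
  cases L with
  | nil => rfl
  | cons j K =>
    change T i (T i f) (j :: K) = 0
    rw [T_cons]
    split_ifs with h
    · exact T_of_head_ne _ _ _ h.2
    · rfl

/-- The unit `1 + T i`. -/
def U {n : ℕ} (i : Fin n) : (Module.End ℤ (Mod n))ˣ where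
  val := 1 + T i
  inv := 1 - T i
  val_inv := by
    have := T_sq i
    calc (1 + T i) * (1 - T i) = 1 - T i * T i := by noncomm_ring
      _ = 1 := by rw [this, sub_zero]
  inv_val := by
    have := T_sq i
    calc (1 - T i) * (1 + T i) = 1 - T i * T i := by noncomm_ring
      _ = 1 := by rw [this, sub_zero]

/-- The representation. -/
def rho (n : ℕ) : FreeGroup (Fin n) →* (Module.End ℤ (Mod n))ˣ := FreeGroup.lift U

/-- The sign of a letter. -/
def sg (b : Bool) : ℤ := if b then 1 else -1

lemma sg_sq (b : Bool) : sg b * sg b = 1 := by cases b <;> rfl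

lemma rho_letter {n : ℕ} (i : Fin n) (b : Bool) (f : Mod n) (K : List (Fin n)) :
    (rho n (FreeGroup.mk [(i, b)]) : Module.End ℤ (Mod n)) f K = f K + sg b * T i f K := by
  cases b
  · have : rho n (FreeGroup.mk [(i, false)]) = (U i)⁻¹ := by simp [rho]
    rw [this]
    change (f - T i f) K = _
    simp [sg, sub_eq_add_neg]
  · have : rho n (FreeGroup.mk [(i, true)]) = U i := by simp [rho]
    rw [this]
    change (f + T i f) K = _
    simp [sg]

/-- Indicator of the empty word. -/
def dl (n : ℕ) : Mod n := fun L => if L = [] then 1 else 0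

lemma rho_cons {n : ℕ} (i : Fin n) (b : Bool) (W : List (Fin n × Bool)) (f : Mod n)
    (K : List (Fin n)) :
    (rho n (FreeGroup.mk ((i, b) :: W)) : Module.End ℤ (Mod n)) f K =
      (rho n (FreeGroup.mk W) : Module.End ℤ (Mod n)) f K
        + sg b * T i ((rho n (FreeGroup.mk W) : Module.End ℤ (Mod n)) f) K := by
  have : FreeGroup.mk ((i, b) :: W) = FreeGroup.mk [(i, b)] * FreeGroup.mk W := by
    rw [FreeGroup.mul_mk]; rfl
  rw [this, map_mul, Units.val_mul, Module.End.mul_apply, rho_letter]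

lemma word_top {n : ℕ} (W : List (Fin n × Bool)) : ∀ (i : Fin n) (b : Bool),
    FreeGroup.IsReduced ((i, b) :: W) → ∃ L : List (Fin n), L.head? ≠ some i ∧
      0 < (rho n (FreeGroup.mk ((i, b) :: W)) : Module.End ℤ (Mod n)) (dl n) L *
        (rho n (FreeGroup.mk ((i, b) :: W)) : Module.End ℤ (Mod n)) (dl n) (i :: L) * sg b ∧
      ∀ K : List (Fin n), (rho n (FreeGroup.mk ((i, b) :: W)) : Module.End ℤ (Mod n)) (dl n) K ≠ 0 →
        K.length ≤ L.length + 1 ∧ (K.length = L.length + 1 → K.head? = some i) := by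
  induction W with
  | nil =>
    intro i b _
    have hone : (rho n (FreeGroup.mk []) : Module.End ℤ (Mod n)) (dl n) = dl n := by
      rw [← FreeGroup.one_eq_mk]; simp
    refine ⟨[], by simp, ?_, ?_⟩
    · rw [rho_cons, rho_cons, hone]
      cases b <;> simp [T_nil, T_cons, dl, sg]
    · intro K
      rw [rho_cons, hone]
      cases K with
      | nil => simp
      | cons j K =>
        rw [T_cons]
        by_cases hj : j = i <;> by_cases hK : K = [] <;> simp [dl, hj, hK]
  | cons a W ih =>
    obtain ⟨j, c⟩ := a
    intro i b hred
    have hred' : FreeGroup.IsReduced ((j, c) :: W) := by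
      unfold FreeGroup.IsReduced at hred ⊢
      exact hred.tail
    have hrel : j = i → c = b := by
      unfold FreeGroup.IsReduced at hred
      rw [List.isChain_cons_cons] at hred
      intro h
      exact (hred.1 h.symm).symm
    obtain ⟨L, hL, hpos, hsup⟩ := ih j c hred'
    simp only [rho_cons i b]
    set v := (rho n (FreeGroup.mk ((j, c) :: W)) : Module.End ℤ (Mod n)) (dl n) with hv
    by_cases hij : j = i
    · obtain rfl := hrel hij
      subst hij
      refine ⟨L, hL, ?_, ?_⟩
      · rw [T_of_head_ne _ _ _ hL, T_cons, if_pos ⟨rfl, hL⟩]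
        have h1 := sg_sq c
        have h2 := sq_nonneg (v L)
        calc (0:ℤ) < v L * v (j :: L) * sg c + (v L)^2 * (sg c * sg c) := by rw [h1]; linarith
          _ = _ := by ring
      · intro K hK
        by_cases hK1 : v K = 0
        · cases K with
          | nil => simp [hK1, T_nil] at hK
          | cons k K =>
            rw [hK1, T_cons] at hK
            split_ifs at hK with h
            · have h3 : v K ≠ 0 := by
                intro h3; simp [h3] at hK
              have := hsup K h3
              obtain ⟨rfl, h⟩ := h
              have h4 : K.length ≠ L.length + 1 := fun h5 => h (this.2 h5)
              simp only [List.length_cons, List.head?_cons, implies_true, and_true]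
              omega
            · simp at hK
        · exact hsup K hK1
    · have hne : v (j :: L) ≠ 0 := by
        intro h; simp [h] at hpos
      have hhead : (j :: L).head? ≠ some i := by simpa using hij
      refine ⟨j :: L, hhead, ?_, ?_⟩
      · have h0 : v (i :: j :: L) = 0 := by
          by_contra h
          have := (hsup _ h).1
          simp at this
        rw [T_of_head_ne _ _ _ hhead, T_cons, if_pos ⟨rfl, hhead⟩, h0]
        have h1 := sg_sq b
        have h2 : 0 < (v (j :: L))^2 := by positivity
        calc (0:ℤ) < (v (j :: L))^2 * (sg b * sg b) := by rw [h1]; linarith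
          _ = _ := by ring
      · intro K hK
        by_cases hK1 : v K = 0
        · cases K with
          | nil => simp [hK1, T_nil] at hK
          | cons k K =>
            rw [hK1, T_cons] at hK
            split_ifs at hK with h
            · have h3 : v K ≠ 0 := by
                intro h3; simp [h3] at hK
              have := hsup K h3
              obtain ⟨rfl, h⟩ := h
              simp only [List.length_cons, List.head?_cons, implies_true, and_true]
              omega
            · simp at hK
        · have := (hsup K hK1).1
          simp only [List.length_cons]
          exact ⟨by omega, by omega⟩

lemma rho_faithful {n : ℕ} (g : FreeGroup (Fin n))
    (h : (rho n g : Module.End ℤ (Mod n)) (dl n) = dl n) : g = 1 := by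
  have hr : FreeGroup.IsReduced g.toWord := FreeGroup.isReduced_toWord
  have hg : FreeGroup.mk g.toWord = g := FreeGroup.mk_toWord
  cases hW : g.toWord with
  | nil => exact FreeGroup.toWord_eq_nil_iff.mp hW
  | cons a W =>
    obtain ⟨i, b⟩ := a
    rw [hW] at hr hg
    obtain ⟨L, -, hpos, -⟩ := word_top W i b hr
    rw [hg, h] at hpos
    simp [dl] at hpos


/-- The integral group ring. -/
abbrev S (n : ℕ) := MonoidAlgebra ℤ (FreeGroup (Fin n))

/-- Group elements in the group ring. -/
noncomputable def o {n : ℕ} : FreeGroup (Fin n) →* S n := MonoidAlgebra.of ℤ _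

/-- The augmentation ideal mod `l`, as an additive subgroup. -/
noncomputable def J (n l : ℕ) : Submodule ℤ (S n) :=
  Submodule.span ℤ ({(l : S n)} ∪ Set.range (fun g => o g - 1))

lemma J_l (n l : ℕ) : (l : S n) ∈ J n l := Submodule.subset_span (by simp)

lemma J_g (n l : ℕ) (g : FreeGroup (Fin n)) : o g - 1 ∈ J n l :=
  Submodule.subset_span (Or.inr ⟨g, rfl⟩)

lemma J_mul {n l c : ℕ} {x y : S n} (hx : x ∈ J n l) (hy : y ∈ J n l ^ c) :
    x * y ∈ J n l ^ (c + 1) := by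
  rw [pow_succ']
  exact Submodule.mul_mem_mul hx hy

lemma J_mul2 {n l : ℕ} {x y : S n} (hx : x ∈ J n l) (hy : y ∈ J n l) :
    x * y ∈ J n l ^ 2 := by
  rw [pow_two]
  exact Submodule.mul_mem_mul hx hy

/-- Abelianization. -/
def ab (n : ℕ) : FreeGroup (Fin n) →* Multiplicative (Fin n → ℤ) :=
  FreeGroup.lift (fun i => Multiplicative.ofAdd (Pi.single i 1))

/-- Exponent vector. -/
def ep {n : ℕ} (g : FreeGroup (Fin n)) : Fin n → ℤ := (ab n g).toAdd

lemma ep_one {n : ℕ} : ep (1 : FreeGroup (Fin n)) = 0 := by simp [ep]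
lemma ep_mul {n : ℕ} (g h : FreeGroup (Fin n)) : ep (g * h) = ep g + ep h := by simp [ep]
lemma ep_inv {n : ℕ} (g : FreeGroup (Fin n)) : ep g⁻¹ = - ep g := by simp [ep]
lemma ep_of {n : ℕ} (i : Fin n) : ep (FreeGroup.of i) = Pi.single i 1 := by simp [ep, ab]

/-- The linear part. -/
noncomputable def lin {n : ℕ} (v : Fin n → ℤ) : S n := ∑ i, v i • (o (FreeGroup.of i) - 1)

lemma lin_add {n : ℕ} (v w : Fin n → ℤ) : lin (v + w) = lin v + lin w := by
  simp [lin, add_smul, Finset.sum_add_distrib]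

lemma lin_neg {n : ℕ} (v : Fin n → ℤ) : lin (-v) = - lin v := by
  simp [lin]

lemma lin_single {n : ℕ} (i : Fin n) : lin (Pi.single i 1) = o (FreeGroup.of i) - 1 := by
  unfold lin
  rw [Finset.sum_eq_single i]
  · simp
  · intro j _ hj; simp [Pi.single_eq_of_ne hj]
  · simp

lemma linear_part {n : ℕ} (l : ℕ) (g : FreeGroup (Fin n)) :
    (o g - 1) - lin (ep g) ∈ J n l ^ 2 := by
  induction g using FreeGroup.induction_on with
  | C1 => simp [ep_one, lin]
  | of i => simp [ep_of, lin_single]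
  | inv_of i ih =>
    rw [ep_inv, lin_neg, ep_of, lin_single]
    have h : o (FreeGroup.of i) * o (FreeGroup.of i)⁻¹ = 1 := by rw [← map_mul]; simp
    have h2 : o (FreeGroup.of i)⁻¹ - 1 - -(o (FreeGroup.of i) - 1) =
        - ((o (FreeGroup.of i) - 1) * (o (FreeGroup.of i)⁻¹ - 1)) := by
      have : (o (FreeGroup.of i) - 1) * (o (FreeGroup.of i)⁻¹ - 1)
        = o (FreeGroup.of i) * o (FreeGroup.of i)⁻¹ - o (FreeGroup.of i) - o (FreeGroup.of i)⁻¹ + 1 := by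
          noncomm_ring
      rw [this, h]; abel
    rw [h2]
    exact Submodule.neg_mem _ (J_mul2 (J_g _ _ _) (J_g _ _ _))
  | mul g h ihg ihh =>
    rw [ep_mul, lin_add, map_mul]
    have : o g * o h - 1 - (lin (ep g) + lin (ep h)) =
      (o g - 1 - lin (ep g)) + (o h - 1 - lin (ep h)) + (o g - 1) * (o h - 1) := by
      noncomm_ring
    rw [this]
    exact add_mem (add_mem ihg ihh) (J_mul2 (J_g _ _ _) (J_g _ _ _))

lemma lin_mem {n l : ℕ} (v : Fin n → ℤ) (hv : ∀ i, (l : ℤ) ∣ v i) : lin v ∈ J n l ^ 2 := by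
  unfold lin
  refine Submodule.sum_mem _ fun i _ => ?_
  obtain ⟨c, hc⟩ := hv i
  have : v i • (o (FreeGroup.of i) - 1) = c • ((l : S n) * (o (FreeGroup.of i) - 1)) := by
    rw [hc, mul_comm, mul_smul]
    congr 1
    simp
  rw [this]
  exact Submodule.smul_mem _ _ (J_mul2 (J_l _ _) (J_g _ _ _))

/-- The induced map on the group ring. -/
noncomputable def Th {n : ℕ} (θ : FreeGroup (Fin n) →* FreeGroup (Fin n)) : S n →ₐ[ℤ] S n :=
  MonoidAlgebra.lift ℤ _ _ (o.comp θ)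

lemma Th_o {n : ℕ} (θ : FreeGroup (Fin n) →* FreeGroup (Fin n)) (g) : Th θ (o g) = o (θ g) := by
  simp [Th, o]

lemma Th_J {n l : ℕ} (θ : FreeGroup (Fin n) →* FreeGroup (Fin n)) :
    ∀ x ∈ J n l, Th θ x ∈ J n l := by
  intro x hx
  unfold J at hx
  induction hx using Submodule.span_induction with
  | mem x hx =>
    rcases hx with rfl | ⟨g, rfl⟩
    · rw [map_natCast]; exact J_l _ _
    · simp only [map_sub, Th_o, map_one]; exact J_g _ _ _
  | zero => simp
  | add x y _ _ hx hy => rw [map_add]; exact add_mem hx hy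
  | smul c x _ hx => rw [map_smul]; exact Submodule.smul_mem _ _ hx

lemma Th_Jpow {n l : ℕ} (θ : FreeGroup (Fin n) →* FreeGroup (Fin n)) (c : ℕ) :
    ∀ x ∈ J n l ^ c, Th θ x ∈ J n l ^ c := by
  intro x hx
  have h := Submodule.map_pow (J n l) (Th θ) c
  have h1 : (Th θ).toLinearMap x ∈ Submodule.map (Th θ).toLinearMap (J n l ^ c) :=
    Submodule.mem_map_of_mem hx
  rw [h] at h1
  have h2 : Submodule.map (Th θ).toLinearMap (J n l) ≤ J n l := by
    rintro _ ⟨y, hy, rfl⟩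
    exact Th_J θ y hy
  have h3 : Submodule.map (Th θ).toLinearMap (J n l) ^ c ≤ J n l ^ c := pow_le_pow_left' h2 c
  exact h3 h1

lemma Th_sub {n l : ℕ} (θ : FreeGroup (Fin n) →* FreeGroup (Fin n))
    (hθ : ∀ g i, (l : ℤ) ∣ ep (θ g) i - ep g i) (c : ℕ) :
    ∀ x ∈ J n l ^ (c + 1), Th θ x - x ∈ J n l ^ (c + 2) := by
  have h1 : ∀ x ∈ J n l, Th θ x - x ∈ J n l ^ 2 := by
    intro x hx
    unfold J at hx
    induction hx using Submodule.span_induction with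
    | mem x hx =>
      rcases hx with rfl | ⟨g, rfl⟩
      · rw [map_natCast, sub_self]; exact zero_mem _
      · simp only [map_sub, Th_o, map_one]
        have h2 : o (θ g) - 1 - (o g - 1) = (o (θ g) - 1 - lin (ep (θ g)))
          - (o g - 1 - lin (ep g)) + lin (ep (θ g) + - ep g) := by
          rw [lin_add, lin_neg]; abel
        rw [h2]
        refine add_mem (sub_mem (linear_part _ _) (linear_part _ _)) (lin_mem _ ?_)
        intro i
        have := hθ g i
        simpa [sub_eq_add_neg] using this
    | zero => simp
    | add x y _ _ hx hy => rw [map_add, add_sub_add_comm]; exact add_mem hx hy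
    | smul c x _ hx => rw [map_smul, ← smul_sub]; exact Submodule.smul_mem _ _ hx
  induction c with
  | zero => simpa using h1
  | succ c ih =>
    intro x hx
    rw [pow_succ'] at hx
    induction hx using Submodule.mul_induction_on' with
    | mem_mul_mem a ha b hb =>
      have : Th θ (a * b) - a * b = (Th θ a - a) * Th θ b + a * (Th θ b - b) := by
        rw [map_mul]; noncomm_ring
      rw [this]
      refine add_mem ?_ (J_mul ha (ih b hb))
      have := Submodule.mul_mem_mul (h1 a ha) (Th_Jpow θ _ b hb)
      rw [← pow_add] at this
      convert this using 2
      ring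
    | add x _ y _ hx hy => rw [map_add, add_sub_add_comm]; exact add_mem hx hy

/-- Action of the group ring. -/
noncomputable def act (n : ℕ) : S n →ₐ[ℤ] Module.End ℤ (Mod n) :=
  MonoidAlgebra.lift ℤ _ _ ((Units.coeHom _).comp (rho n))

lemma act_o {n : ℕ} (g : FreeGroup (Fin n)) : act n (o g) = rho n g := by
  simp [act, o]

/-- Filtration condition on the module. -/
def Fil {n : ℕ} (l c : ℕ) (f : Mod n) : Prop := ∀ L, (l : ℤ) ^ c ∣ (l : ℤ) ^ L.length * f L

lemma Fil.add {n l c : ℕ} {f g : Mod n} (hf : Fil l c f) (hg : Fil l c g) : Fil l c (f + g) := by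
  intro L
  rw [Pi.add_apply, mul_add]
  exact dvd_add (hf L) (hg L)

lemma Fil.smul {n l c : ℕ} {f : Mod n} (hf : Fil l c f) (a : ℤ) : Fil l c (a • f) := by
  intro L
  rw [Pi.smul_apply, smul_eq_mul, mul_left_comm]
  exact (hf L).mul_left _

lemma Fil.down {n l c : ℕ} {f : Mod n} (hf : Fil l (c + 1) f) : Fil l c f := fun L =>
  (pow_dvd_pow _ (Nat.le_succ c)).trans (hf L)

lemma Fil.T {n l c : ℕ} {f : Mod n} (hf : Fil l c f) (i : Fin n) : Fil l (c + 1) (T i f) := by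
  intro L
  cases L with
  | nil => simp [T_nil]
  | cons j K =>
    rw [T_cons]
    split_ifs
    · rw [List.length_cons, pow_succ', pow_succ', mul_assoc]
      exact mul_dvd_mul_left _ (hf K)
    · simp

lemma Fil.g {n : ℕ} (l : ℕ) (g : FreeGroup (Fin n)) : ∀ (c : ℕ) (f : Mod n), Fil l c f →
    Fil l (c + 1) ((rho n g : Module.End ℤ (Mod n)) f - f) := by
  induction g using FreeGroup.induction_on with
  | C1 => intro c f _ L; simp
  | of i =>
    intro c f hf
    have : (rho n (FreeGroup.of i) : Module.End ℤ (Mod n)) f - f = PerFix.T i f := by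
      have : rho n (FreeGroup.of i) = U i := by simp [rho]
      rw [this]
      change f + PerFix.T i f - f = _
      abel
    rw [this]
    exact hf.T i
  | inv_of i _ =>
    intro c f hf
    have : (rho n (FreeGroup.of i)⁻¹ : Module.End ℤ (Mod n)) f - f = (-1 : ℤ) • PerFix.T i f := by
      have : rho n (FreeGroup.of i)⁻¹ = (U i)⁻¹ := by simp [rho]
      rw [this]
      change f - PerFix.T i f - f = _
      rw [neg_one_smul]
      abel
    rw [this]
    exact (hf.T i).smul _
  | mul g h hg hh =>
    intro c f hf
    have h1 := hh c f hf
    have h2 : Fil l c ((rho n h : Module.End ℤ (Mod n)) f) := by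
      have := h1.down.add hf
      simpa using this
    have h3 := (hg c _ h2).add h1
    rw [map_mul, Units.val_mul, Module.End.mul_apply]
    simpa using h3

lemma Fil.J {n l c : ℕ} {x : S n} (hx : x ∈ J n l) {f : Mod n} (hf : Fil l c f) :
    Fil l (c + 1) (act n x f) := by
  unfold PerFix.J at hx
  induction hx using Submodule.span_induction with
  | mem x hx =>
    rcases hx with rfl | ⟨g, rfl⟩
    · intro L
      have : act n (l : S n) f L = l * f L := by
        rw [map_natCast]
        simp
      rw [this, pow_succ', mul_left_comm]
      exact mul_dvd_mul_left _ (hf L)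
    · simp only [map_sub, act_o, map_one]
      exact Fil.g l g c f hf
  | zero => intro L; simp
  | add x y _ _ hx hy => rw [map_add]; exact hx.add hy
  | smul a x _ hx => rw [map_smul]; exact hx.smul a

lemma Fil.Jpow {n l : ℕ} (c : ℕ) : ∀ {x : S n} (_ : x ∈ PerFix.J n l ^ c) (f : Mod n),
    Fil l c (act n x f) := by
  induction c with
  | zero => intro x _ f L; simp
  | succ c ih =>
    intro x hx f
    rw [pow_succ'] at hx
    induction hx using Submodule.mul_induction_on' with
    | mem_mul_mem a ha b hb =>
      rw [map_mul, Module.End.mul_apply]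
      exact Fil.J ha (ih hb f)
    | add x _ y _ hx hy => rw [map_add]; exact hx.add hy

lemma separated {n l : ℕ} (hl : 2 ≤ l) (g h : FreeGroup (Fin n))
    (H : ∀ c, o g - o h ∈ J n l ^ (c + 1)) : g = h := by
  have h1 : (rho n g : Module.End ℤ (Mod n)) (dl n) = (rho n h : Module.End ℤ (Mod n)) (dl n) := by
    funext L
    rw [← sub_eq_zero]
    by_contra hne
    set z := (rho n g : Module.End ℤ (Mod n)) (dl n) L - (rho n h : Module.End ℤ (Mod n)) (dl n) L
      with hz
    have h2 : ∀ c, (l : ℤ) ^ (c + 1) ∣ (l : ℤ) ^ L.length * z := by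
      intro c
      have := Fil.Jpow (c + 1) (H c) (dl n) L
      rw [map_sub, act_o, act_o] at this
      exact this
    have hz0 : (l : ℤ) ^ L.length * z ≠ 0 := mul_ne_zero (pow_ne_zero _ (by omega)) hne
    set y := (l : ℤ) ^ L.length * z
    have h3 := Int.le_of_dvd (abs_pos.mpr hz0) ((dvd_abs _ _).mpr (h2 y.natAbs))
    have h4 : (y.natAbs + 1) < l ^ (y.natAbs + 1) := Nat.lt_pow_self (by omega)
    have h5 : |y| = (y.natAbs : ℤ) := by simp
    rw [h5] at h3
    have h6 : l ^ (y.natAbs + 1) ≤ y.natAbs := by exact_mod_cast h3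
    omega
  have h2 : h⁻¹ * g = 1 := by
    apply rho_faithful
    rw [map_mul, Units.val_mul, Module.End.mul_apply, h1, ← Module.End.mul_apply, ← Units.val_mul,
      ← map_mul]
    simp
  exact (inv_mul_eq_one.mp h2).symm

lemma fixed_of_coprime {n l m : ℕ} (hl : l.Prime) (θ : MulAut (FreeGroup (Fin n)))
    (hθ : ∀ g i, (l : ℤ) ∣ ep (θ g) i - ep g i) (w : FreeGroup (Fin n)) (hm : ¬ l ∣ m)
    (hw : (θ ^ m) w = w) : θ w = w := by
  apply separated hl.two_le
  set t := Th θ.toMonoidHom with ht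
  have hto : ∀ g, t (o g) = o (θ g) := fun g => Th_o _ g
  set y := o (θ w) - o w with hy
  have hcop : IsCoprime (m : ℤ) (l : ℤ) := by
    rw [Nat.isCoprime_iff_coprime]
    exact ((Nat.Prime.coprime_iff_not_dvd hl).mpr hm).symm
  intro c
  induction c with
  | zero =>
    have : y = (o (θ w) - 1) - (o w - 1) := by rw [hy]; abel
    rw [zero_add, pow_one, this]
    exact sub_mem (J_g _ _ _) (J_g _ _ _)
  | succ c ih =>
    have key : ∀ j : ℕ, o ((θ ^ j) (θ w)) - o ((θ ^ j) w) - y ∈ J n l ^ (c + 2) ∧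
        o ((θ ^ j) (θ w)) - o ((θ ^ j) w) ∈ J n l ^ (c + 1) := by
      intro j
      induction j with
      | zero => simpa [← hy] using ih
      | succ j hj =>
        obtain ⟨ha, hb⟩ := hj
        have e : ∀ g, o ((θ ^ (j + 1)) g) = t (o ((θ ^ j) g)) := by
          intro g; rw [hto, pow_succ']; rfl
        rw [e, e, ← map_sub]
        refine ⟨?_, Th_Jpow _ _ _ hb⟩
        have := add_mem (Th_sub θ.toMonoidHom hθ c _ hb) ha
        rw [← ht] at this
        simpa using this
    have sum : ∀ j : ℕ, o ((θ ^ j) w) - o w - (j : ℤ) • y ∈ J n l ^ (c + 2) := by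
      intro j
      induction j with
      | zero => simp
      | succ j hj =>
        have e : (θ ^ (j + 1)) w = (θ ^ j) (θ w) := by rw [pow_succ]; rfl
        have := add_mem hj (key j).1
        rw [e]
        convert this using 1
        push_cast
        rw [add_smul, one_smul]
        abel
    have h1 := sum m
    rw [hw, sub_self, zero_sub] at h1
    have h1 := neg_mem h1
    rw [neg_neg] at h1
    have h2 : (l : ℤ) • y ∈ J n l ^ (c + 2) := by
      have := J_mul (J_l n l) ih
      convert this using 1
      simp
    obtain ⟨a, b, hab⟩ := hcop
    have : y = a • ((m : ℤ) • y) + b • ((l : ℤ) • y) := by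
      rw [← mul_smul, ← mul_smul, ← add_smul, hab, one_smul]
    rw [this]
    exact add_mem (Submodule.smul_mem _ _ h1) (Submodule.smul_mem _ _ h2)


lemma prime_pow_dvd_lcm {p a x y : ℕ} (hp : p.Prime) (hx : x ≠ 0) (hy : y ≠ 0)
    (h : p ^ a ∣ Nat.lcm x y) : p ^ a ∣ x ∨ p ^ a ∣ y := by
  have h0 : Nat.lcm x y ≠ 0 := Nat.lcm_ne_zero hx hy
  rw [hp.pow_dvd_iff_le_factorization h0, Nat.factorization_lcm hx hy] at h
  rw [hp.pow_dvd_iff_le_factorization hx, hp.pow_dvd_iff_le_factorization hy]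
  simpa using h

lemma exists_lcm (l n : ℕ) (hl : 2 ≤ l) : ∃ N : ℕ, N ≠ 0 ∧
    (∀ i, 1 ≤ i → i ≤ n → (l ^ i - 1) ∣ N) ∧
    ∀ p a : ℕ, p.Prime → a ≠ 0 → p ^ a ∣ N → ∃ i, 1 ≤ i ∧ i ≤ n ∧ p ^ a ∣ l ^ i - 1 := by
  induction n with
  | zero =>
    refine ⟨1, one_ne_zero, fun i h1 h2 => by omega, fun p a hp ha h => ?_⟩
    have := Nat.dvd_one.mp h
    rw [Nat.pow_eq_one] at this
    exact absurd this (by have := hp.one_lt; omega)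
  | succ n ih =>
    obtain ⟨N, hN, h1, h2⟩ := ih
    have hne : l ^ (n + 1) - 1 ≠ 0 := by
      have : 1 < l ^ (n + 1) := Nat.one_lt_pow (by omega) (by omega)
      omega
    refine ⟨Nat.lcm N (l ^ (n + 1) - 1), Nat.lcm_ne_zero hN hne, ?_, ?_⟩
    · intro i hi hi2
      rcases Nat.lt_or_ge n i with h | h
      · obtain rfl : i = n + 1 := by omega
        exact Nat.dvd_lcm_right _ _
      · exact (h1 i hi h).trans (Nat.dvd_lcm_left _ _)
    · intro p a hp ha h
      rcases prime_pow_dvd_lcm hp hN hne h with h | h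
      · obtain ⟨i, a1, a2, a3⟩ := h2 p a hp ha h
        exact ⟨i, a1, by omega, a3⟩
      · exact ⟨n + 1, by omega, le_rfl, h⟩

open Polynomial in
lemma poly_dvd {l : ℕ} [Fact l.Prime] {n N : ℕ}
    (hN : ∀ i, 1 ≤ i → i ≤ n → (l ^ i - 1) ∣ N) (d : ℕ) :
    ∀ f : (ZMod l)[X], f.natDegree ≤ d → d ≤ n → f.coeff 0 ≠ 0 → f ∣ (X ^ N - 1) ^ d := by
  induction d with
  | zero =>
    intro f hf _ h0
    rw [Polynomial.eq_C_of_natDegree_le_zero hf]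
    rw [pow_zero]
    exact (Polynomial.isUnit_C.mpr (isUnit_iff_ne_zero.mpr h0)).dvd
  | succ d ih =>
    intro f hf hd h0
    rcases Nat.eq_zero_or_pos f.natDegree with h | h
    · exact (ih f (by omega) (by omega) h0).trans (pow_dvd_pow _ (Nat.le_succ _))
    obtain ⟨g, hg, q, rfl⟩ := Polynomial.exists_irreducible_of_natDegree_pos h
    rw [Polynomial.mul_coeff_zero] at h0
    have hg0 := left_ne_zero_of_mul h0
    have hq0 := right_ne_zero_of_mul h0
    have hqne : q ≠ 0 := by rintro rfl; simp at hq0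
    rw [Polynomial.natDegree_mul hg.ne_zero hqne] at hf
    have hgd := hg.natDegree_pos
    rw [pow_succ']
    refine mul_dvd_mul ?_ (ih q (by omega) (by omega) hq0)
    have h1 : g ∣ X ^ (Nat.card (ZMod l)) ^ g.natDegree - X :=
      hg.natDegree_dvd_iff_dvd_X_pow_card_pow_sub_X.mp dvd_rfl
    rw [Nat.card_zmod] at h1
    have hpos : 1 ≤ l ^ g.natDegree := Nat.one_le_pow _ _ (Fact.out : l.Prime).pos
    have h2 : (X : (ZMod l)[X]) ^ l ^ g.natDegree - X = X * (X ^ (l ^ g.natDegree - 1) - 1) := by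
      rw [mul_sub, mul_one, ← pow_succ', Nat.sub_add_cancel hpos]
    rw [h2] at h1
    rcases hg.prime.dvd_or_dvd h1 with h3 | h3
    · exfalso
      have h4 : X ∣ g := (hg.dvd_comm Polynomial.irreducible_X).mp h3
      exact hg0 (Polynomial.X_dvd_iff.mp h4)
    · refine h3.trans ?_
      obtain ⟨c, hc⟩ := hN g.natDegree hgd (by omega)
      rw [hc, pow_mul]
      simpa using sub_dvd_pow_sub_pow ((X : (ZMod l)[X]) ^ (l ^ g.natDegree - 1)) 1 c

open Polynomial in
lemma mat_pow {l : ℕ} [Fact l.Prime] {n N : ℕ}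
    (hN : ∀ i, 1 ≤ i → i ≤ n → (l ^ i - 1) ∣ N) (A : Matrix (Fin n) (Fin n) (ZMod l))
    (hA : IsUnit A) : A ^ (N * l ^ n) = 1 := by
  have h0 : A.charpoly.coeff 0 ≠ 0 := by
    intro h
    have := A.det_eq_sign_charpoly_coeff
    rw [h, mul_zero] at this
    rw [Matrix.isUnit_iff_isUnit_det, this] at hA
    simp at hA
  have h1 := poly_dvd hN n A.charpoly (by simp [Matrix.charpoly_natDegree_eq_dim]) le_rfl h0
  have h2 : A.charpoly ∣ X ^ (N * l ^ n) - 1 := by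
    have h3 : (X : (ZMod l)[X]) ^ (N * l ^ n) - 1 = (X ^ N - 1) ^ (l ^ n) := by
      rw [sub_pow_char_pow, one_pow, pow_mul]
    rw [h3]
    refine h1.trans (pow_dvd_pow _ ?_)
    exact (Nat.lt_pow_self (Fact.out : l.Prime).one_lt).le
  obtain ⟨q, hq⟩ := h2
  have h4 := congrArg (aeval A) hq
  rw [map_mul, Matrix.aeval_self_charpoly, zero_mul] at h4
  simpa [sub_eq_zero] using h4

lemma exists_good_prime {p a n : ℕ} (hp : p.Prime) (ha : a ≠ 0) (hn : 2 ≤ n)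
    (H : ∀ l : ℕ, l.Prime → l ≠ p → ∃ i, 1 ≤ i ∧ i ≤ n ∧ p ^ a ∣ l ^ i - 1) :
    p ^ a ∣ (6 * n - 6).factorial := by
  have : NeZero (p ^ a) := ⟨pow_ne_zero _ hp.ne_zero⟩
  have key : ∀ u : (ZMod (p ^ a))ˣ, orderOf (u : ZMod (p ^ a)) ≤ n := by
    intro u
    obtain ⟨l, hlp, hl, hlu⟩ := Nat.forall_exists_prime_gt_and_eq_mod u.isUnit p
    obtain ⟨i, hi, hin, hd⟩ := H l hl (by omega)
    have h1 : ((l ^ i - 1 : ℕ) : ZMod (p ^ a)) = 0 := (ZMod.natCast_eq_zero_iff _ _).mpr hd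
    rw [Nat.cast_sub (Nat.one_le_pow _ _ hl.pos)] at h1
    push_cast at h1
    rw [hlu, sub_eq_zero] at h1
    exact (Nat.le_of_dvd (by omega) (orderOf_dvd_of_pow_eq_one h1)).trans hin
  by_cases hp2 : p = 2
  · subst hp2
    rcases Nat.lt_or_ge a 2 with h | h
    · obtain rfl : a = 1 := by omega
      exact Nat.dvd_factorial (by norm_num) (by omega)
    obtain ⟨b, rfl⟩ : ∃ b, a = b + 2 := ⟨a - 2, by omega⟩
    have h5 : IsUnit (5 : ZMod (2 ^ (b + 2))) := by
      have : IsUnit ((5 : ℕ) : ZMod (2 ^ (b + 2))) := by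
        rw [ZMod.isUnit_iff_coprime]
        exact Nat.Coprime.pow_right _ (by norm_num)
      simpa using this
    have h6 := key h5.unit
    rw [IsUnit.unit_spec, ZMod.orderOf_five] at h6
    rcases Nat.lt_or_ge 2 n with h7 | h7
    · refine Nat.dvd_factorial (by positivity) ?_
      rw [pow_add]; omega
    · obtain rfl : n = 2 := by omega
      have hb : b ≤ 1 := by
        by_contra hb
        have : 2 ^ 2 ≤ 2 ^ b := Nat.pow_le_pow_right (by norm_num) (by omega)
        omega
      refine (pow_dvd_pow 2 (show b + 2 ≤ 3 by omega)).trans ?_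
      decide
  · have := ZMod.isCyclic_units_of_prime_pow p hp hp2 a
    obtain ⟨u, hu⟩ := IsCyclic.exists_ofOrder_eq_natCard (α := (ZMod (p ^ a))ˣ)
    have h1 := key u
    rw [orderOf_units, hu, Nat.card_eq_fintype_card, ZMod.card_units_eq_totient,
      Nat.totient_prime_pow hp (by omega)] at h1
    refine Nat.dvd_factorial (Nat.pow_pos hp.pos) ?_
    obtain ⟨b, rfl⟩ : ∃ b, a = b + 1 := ⟨a - 1, by omega⟩
    obtain ⟨q, rfl⟩ : ∃ q, p = q + 2 := ⟨p - 2, by have := hp.two_le; omega⟩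
    simp only [Nat.add_sub_cancel, show q + 2 - 1 = q + 1 by omega] at h1
    have : (q + 2) ^ (b + 1) ≤ 2 * ((q + 2) ^ b * (q + 1)) := by
      rw [pow_succ]
      nlinarith [Nat.zero_le ((q + 2) ^ b * q)]
    omega


/-- Matrix of an automorphism on the abelianization mod `l`. -/
def mat {n : ℕ} (l : ℕ) (φ : MulAut (FreeGroup (Fin n))) : Matrix (Fin n) (Fin n) (ZMod l) :=
  fun i j => (ep (φ (FreeGroup.of j)) i : ZMod l)

/-- Exponent vector mod `l`. -/
def epl {n : ℕ} (l : ℕ) (g : FreeGroup (Fin n)) : Fin n → ZMod l := fun i => (ep g i : ZMod l)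

lemma epl_one {n l : ℕ} : epl l (1 : FreeGroup (Fin n)) = 0 := by
  funext i; simp [epl, ep_one]

lemma epl_mul {n l : ℕ} (g h : FreeGroup (Fin n)) : epl l (g * h) = epl l g + epl l h := by
  funext i; simp [epl, ep_mul]

lemma epl_inv {n l : ℕ} (g : FreeGroup (Fin n)) : epl l g⁻¹ = - epl l g := by
  funext i; simp [epl, ep_inv]

lemma epl_of {n l : ℕ} (i : Fin n) : epl l (FreeGroup.of i) = Pi.single i 1 := by
  funext j
  by_cases h : j = i
  · subst h; simp [epl, ep_of]
  · simp [epl, ep_of, Pi.single_eq_of_ne h]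

lemma mat_epl {n l : ℕ} (φ : MulAut (FreeGroup (Fin n))) (g : FreeGroup (Fin n)) :
    (mat l φ).mulVec (epl l g) = epl l (φ g) := by
  induction g using FreeGroup.induction_on with
  | C1 => rw [map_one, epl_one, Matrix.mulVec_zero]
  | of i =>
    rw [epl_of, Matrix.mulVec_single_one]
    rfl
  | inv_of i ih => rw [map_inv, epl_inv, epl_inv, Matrix.mulVec_neg, ih]
  | mul g h hg hh => rw [map_mul, epl_mul, epl_mul, Matrix.mulVec_add, hg, hh]

lemma mat_mul {n l : ℕ} (φ ψ : MulAut (FreeGroup (Fin n))) :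
    mat l φ * mat l ψ = mat l (φ * ψ) := by
  ext i j
  have h := congrFun (mat_epl (l := l) φ (ψ (FreeGroup.of j))) i
  exact h

lemma mat_one {n l : ℕ} : mat l (1 : MulAut (FreeGroup (Fin n))) = 1 := by
  ext i j
  have h := congrFun (epl_of (l := l) j) i
  rw [Matrix.one_apply]
  change epl l (FreeGroup.of j) i = _
  rw [h, Pi.single_apply]

lemma mat_pow' {n l : ℕ} (φ : MulAut (FreeGroup (Fin n))) (m : ℕ) :
    mat l φ ^ m = mat l (φ ^ m) := by
  induction m with
  | zero => rw [pow_zero, pow_zero, mat_one]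
  | succ m ih => rw [pow_succ, pow_succ, ih, mat_mul]

lemma mat_isUnit {n l : ℕ} (φ : MulAut (FreeGroup (Fin n))) : IsUnit (mat l φ) :=
  ⟨⟨mat l φ, mat l φ⁻¹, by rw [mat_mul, mul_inv_cancel, mat_one],
    by rw [mat_mul, inv_mul_cancel, mat_one]⟩, rfl⟩

lemma trivial_of_mat {n l : ℕ} (φ : MulAut (FreeGroup (Fin n))) (h : mat l φ = 1) :
    ∀ g i, (l : ℤ) ∣ ep (φ g) i - ep g i := by
  intro g i
  have h1 := congrFun (mat_epl (l := l) φ g) i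
  rw [h, Matrix.one_mulVec] at h1
  rw [← ZMod.intCast_eq_intCast_iff_dvd_sub]
  exact h1

lemma pow_fix_iff {n : ℕ} (φ : MulAut (FreeGroup (Fin n))) (w : FreeGroup (Fin n)) (m : ℕ) :
    (φ ^ m) w = w ↔ Function.minimalPeriod φ w ∣ m := by
  rw [← Function.isPeriodicPt_iff_minimalPeriod_dvd]
  have : ∀ g, (φ ^ m) g = φ^[m] g := by
    intro g
    induction m generalizing g with
    | zero => rfl
    | succ m ih => rw [pow_succ, Function.iterate_succ_apply, ← ih]; rfl
  rw [this]
  rfl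

lemma period_dvd {n : ℕ} (φ : MulAut (FreeGroup (Fin n))) (w : FreeGroup (Fin n))
    {k p a l : ℕ} (hk : k ≠ 0) (hw : (φ ^ k) w = w) (hp : p.Prime) (ha : a ≠ 0)
    (hpa : p ^ a ∣ Function.minimalPeriod φ w) (hl : l.Prime) (hlp : l ≠ p) :
    ∃ i, 1 ≤ i ∧ i ≤ n ∧ p ^ a ∣ l ^ i - 1 := by
  have : Fact l.Prime := ⟨hl⟩
  obtain ⟨N, -, h1, h2⟩ := exists_lcm l n hl.two_le
  apply h2 p a hp ha
  obtain ⟨e, m, hm, rfl⟩ := Nat.exists_eq_pow_mul_and_not_dvd hk l hl.ne_one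
  have hA : mat l (φ ^ (N * l ^ n * l ^ e)) = 1 := by
    rw [← mat_pow', pow_mul, mat_pow h1 _ (mat_isUnit φ), one_pow]
  have hfix : (φ ^ (N * l ^ n * l ^ e)) w = w := by
    refine fixed_of_coprime hl _ (trivial_of_mat _ hA) w hm ?_
    rw [← pow_mul, pow_fix_iff]
    rw [pow_fix_iff] at hw
    refine hw.trans ⟨N * l ^ n, by ring⟩
  rw [pow_fix_iff] at hfix
  have h3 := hpa.trans hfix
  rw [mul_assoc, ← pow_add] at h3
  refine Nat.Coprime.dvd_of_dvd_mul_right ?_ h3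
  exact Nat.Coprime.pow _ _ ((Nat.coprime_primes hp hl).mpr hlp.symm)

end PerFix


/-- For an automorphism `φ` of the free group of rank `n ≥ 2`, the periodic subgroup
of `φ` equals the fixed subgroup of `φ^((6n-6)!)`: any element fixed by some positive
power of `φ` is fixed by `φ^((6n-6)!)`. -/
theorem periodic_eq_fixed_factorial_pow (n : ℕ) (hn : 2 ≤ n)
    (φ : MulAut (FreeGroup (Fin n))) (w : FreeGroup (Fin n))
    (hw : ∃ k : ℤ, 1 ≤ k ∧ (φ ^ k) w = w) :
    (φ ^ (6 * n - 6).factorial) w = w := by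
  obtain ⟨k, hk, hw⟩ := hw
  lift k to ℕ using by omega
  rw [zpow_natCast] at hw
  rw [PerFix.pow_fix_iff, Nat.dvd_iff_prime_pow_dvd_dvd]
  intro p a hp hpa
  rcases eq_or_ne a 0 with rfl | ha
  · simp
  exact PerFix.exists_good_prime hp ha hn fun l hl hlp =>
    PerFix.period_dvd φ w (by omega) hw hp ha hpa hl hlp
end

section
/- Let n ≥ 2. Every finite-order element of the automorphism group Aut(FreeGroup (Fin n)) has order dividing (6n−6)!; that is, if θ is an automorphism of FreeGroup (Fin n) with θ^m = id for some m ≥ 1, then θ^{(6n−6)!} = id. -/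
open Polynomial in
/-- A finite-order endomorphism: prime powers dividing the order are at most twice the dimension. -/
lemma primePow_le_of_dvd_orderOf {W : Type*} [AddCommGroup W] [Module ℚ W] [FiniteDimensional ℚ W]
    (T : Module.End ℚ W) (ho : 0 < orderOf T) (p k : ℕ) (hp : p.Prime) (hd : p ^ (k + 1) ∣ orderOf T) :
    p ^ (k + 1) ≤ 2 * Module.finrank ℚ W := by
  obtain ⟨c, hc⟩ := hd
  have hc0 : c ≠ 0 := by rintro rfl; rw [mul_zero] at hc; omega
  set S := T ^ c with hS
  have h1 : S ^ p ^ (k + 1) = 1 := by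
    rw [hS, ← pow_mul, mul_comm, ← hc, pow_orderOf_eq_one]
  have h2 : S ^ p ^ k ≠ 1 := by
    rw [hS, ← pow_mul]
    intro h
    have := orderOf_dvd_of_pow_eq_one h
    rw [hc, mul_comm c] at this
    have := Nat.dvd_of_mul_dvd_mul_right (Nat.pos_of_ne_zero hc0) this
    have := (Nat.pow_dvd_pow_iff_le_right hp.one_lt).1 this
    omega
  have hmin : minpoly ℚ S ∣ cyclotomic (p ^ (k + 1)) ℚ * (X ^ p ^ k - 1) := by
    have := Fact.mk hp
    rw [cyclotomic_prime_pow_mul_X_pow_sub_one]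
    apply minpoly.dvd
    simp [h1]
  have hirr : Irreducible (cyclotomic (p ^ (k + 1)) ℚ) :=
    cyclotomic.irreducible_rat (pow_pos hp.pos _)
  have hdvd : cyclotomic (p ^ (k + 1)) ℚ ∣ minpoly ℚ S := by
    by_contra hnd
    have hcop := (hirr.coprime_iff_not_dvd.2 hnd).symm
    have h3 := hcop.dvd_of_dvd_mul_left hmin
    apply h2
    have h4 : aeval S (X ^ p ^ k - 1 : ℚ[X]) = 0 := by
      obtain ⟨q, hq⟩ := h3
      rw [hq, map_mul, minpoly.aeval, zero_mul]
    simpa [sub_eq_zero] using h4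
  have hdeg : Nat.totient (p ^ (k + 1)) ≤ Module.finrank ℚ W := by
    rw [← natDegree_cyclotomic (p ^ (k + 1)) ℚ, ← LinearMap.charpoly_natDegree S]
    exact natDegree_le_of_dvd (hdvd.trans (LinearMap.minpoly_dvd_charpoly S))
      (LinearMap.charpoly_monic S).ne_zero
  rw [Nat.totient_prime_pow_succ hp] at hdeg
  have hp2 := hp.two_le
  calc p ^ (k + 1) = p ^ k * p := pow_succ _ _
    _ ≤ p ^ k * (2 * (p - 1)) := Nat.mul_le_mul_left _ (by omega)
    _ = 2 * (p ^ k * (p - 1)) := by ring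
    _ ≤ _ := by omega

lemma pow_factorial_eq_one {W : Type*} [AddCommGroup W] [Module ℚ W] [FiniteDimensional ℚ W]
    (T : Module.End ℚ W) (m N : ℕ) (hm : 1 ≤ m) (hT : T ^ m = 1)
    (hN : 2 * Module.finrank ℚ W ≤ N) : T ^ N.factorial = 1 := by
  have ho : 0 < orderOf T := orderOf_pos_iff.2 (isOfFinOrder_iff_pow_eq_one.2 ⟨m, hm, hT⟩)
  apply orderOf_dvd_iff_pow_eq_one.1
  rw [Nat.dvd_iff_prime_pow_dvd_dvd]
  intro p k hp hd
  cases k with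
  | zero => simp
  | succ k =>
    exact Nat.dvd_factorial (pow_pos hp.pos _)
      ((primePow_le_of_dvd_orderOf T ho p k hp hd).trans hN)

/-! ### Augmentation ideal -/

/-- The augmentation ideal of the rational group algebra. -/
noncomputable def augI (G : Type*) [Group G] : Submodule ℚ (MonoidAlgebra ℚ G) :=
  Submodule.span ℚ (Set.range fun g : G => MonoidAlgebra.of ℚ G g - 1)

lemma of_sub_one_mem_augI {G : Type*} [Group G] (g : G) :
    MonoidAlgebra.of ℚ G g - 1 ∈ augI G := Submodule.subset_span ⟨g, rfl⟩

/-- The algebra endomorphism induced by a group automorphism. -/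
noncomputable def autAlg {G : Type*} [Group G] (θ : MulAut G) :
    MonoidAlgebra ℚ G →ₐ[ℚ] MonoidAlgebra ℚ G :=
  MonoidAlgebra.lift ℚ _ G ((MonoidAlgebra.of ℚ G).comp θ.toMonoidHom)

lemma autAlg_of {G : Type*} [Group G] (θ : MulAut G) (g : G) :
    autAlg θ (MonoidAlgebra.of ℚ G g) = MonoidAlgebra.of ℚ G (θ g) := by
  simp [autAlg]

lemma autAlg_mul {G : Type*} [Group G] (θ η : MulAut G) :
    (autAlg (θ * η)).toLinearMap = (autAlg θ).toLinearMap * (autAlg η).toLinearMap := by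
  have : autAlg (θ * η) = (autAlg θ).comp (autAlg η) := by
    refine MonoidAlgebra.algHom_ext ?_ (by ext)
    intro g
    have h1 := autAlg_of (θ * η) g
    have h2 := autAlg_of η g
    have h3 := autAlg_of θ (η g)
    simp only [MonoidAlgebra.of_apply] at h1 h2 h3
    simp [h1, h2, h3]
  rw [this]; rfl

lemma autAlg_one {G : Type*} [Group G] :
    (autAlg (1 : MulAut G)).toLinearMap = 1 := by
  have : autAlg (1 : MulAut G) = AlgHom.id ℚ _ := by
    refine MonoidAlgebra.algHom_ext ?_ (by ext)
    intro g
    have h1 := autAlg_of (1 : MulAut G) g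
    simp only [MonoidAlgebra.of_apply] at h1
    simp [h1]
  rw [this]; rfl

lemma autAlg_pow {G : Type*} [Group G] (θ : MulAut G) (k : ℕ) :
    (autAlg (θ ^ k)).toLinearMap = (autAlg θ).toLinearMap ^ k := by
  induction k with
  | zero => simpa using autAlg_one
  | succ k ih => rw [pow_succ, pow_succ, autAlg_mul, ih]

lemma autAlg_mem_augI {G : Type*} [Group G] (θ : MulAut G) {x} (hx : x ∈ augI G) :
    autAlg θ x ∈ augI G := by
  have : augI G ≤ (augI G).comap (autAlg θ).toLinearMap := by
    refine Submodule.span_le.2 ?_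
    rintro _ ⟨g, rfl⟩
    have := of_sub_one_mem_augI (θ g)
    rw [← autAlg_of] at this
    simpa only [SetLike.mem_coe, Submodule.mem_comap, AlgHom.toLinearMap_apply, map_sub, map_one]
      using this
  exact this hx

lemma autAlg_mem_augI_pow {G : Type*} [Group G] (θ : MulAut G) (k : ℕ) :
    ∀ x ∈ augI G ^ k, autAlg θ x ∈ augI G ^ k := by
  have h : (augI G).map (autAlg θ).toLinearMap ≤ augI G := by
    rintro _ ⟨x, hx, rfl⟩; exact autAlg_mem_augI θ hx
  intro x hx
  have h2 : (augI G ^ k).map (autAlg θ).toLinearMap ≤ augI G ^ k := by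
    rw [Submodule.map_pow]; exact pow_le_pow_left' h k
  exact h2 ⟨x, hx, rfl⟩

lemma delta_mem {G : Type*} [Group G] (θ : MulAut G)
    (hθ : ∀ x ∈ augI G, autAlg θ x - x ∈ augI G ^ 2) (k : ℕ) (x) (hx : x ∈ augI G ^ k) :
    autAlg θ x - x ∈ augI G ^ (k + 1) := by
  induction hx using Submodule.pow_induction_on_left' with
  | algebraMap r => rw [AlgHom.commutes, sub_self]; exact zero_mem _
  | add x y i hx hy h1 h2 =>
    have := add_mem h1 h2
    rw [map_add]; convert this using 1; abel
  | mem_mul a ha i x hx ih =>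
    have h1 : autAlg θ a * (autAlg θ x - x) ∈ augI G ^ (i + 1 + 1) := by
      rw [pow_succ']; exact Submodule.mul_mem_mul (autAlg_mem_augI θ ha) ih
    have h2 : (autAlg θ a - a) * x ∈ augI G ^ (i + 1 + 1) := by
      have : i + 1 + 1 = 2 + i := by ring
      rw [this, pow_add]; exact Submodule.mul_mem_mul (hθ a ha) hx
    have := add_mem h1 h2
    rw [map_mul]; convert this using 1; noncomm_ring

lemma delta_of_mem {G : Type*} [Group G] (θ : MulAut G)
    (hθ : ∀ x ∈ augI G, autAlg θ x - x ∈ augI G ^ 2) (m : ℕ) (hm : 1 ≤ m) (h : θ ^ m = 1) (g : G)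
    (k : ℕ) :
    MonoidAlgebra.of ℚ G (θ g) - MonoidAlgebra.of ℚ G g ∈ augI G ^ (k + 1) := by
  induction k with
  | zero =>
    have := sub_mem (of_sub_one_mem_augI (θ g)) (of_sub_one_mem_augI g)
    simpa using this
  | succ k ih =>
    set b := MonoidAlgebra.of ℚ G (θ g) - MonoidAlgebra.of ℚ G g with hb
    have key : ∀ j : ℕ, ∃ e ∈ augI G ^ (k + 1 + 1), 
        MonoidAlgebra.of ℚ G ((θ ^ j) g) = MonoidAlgebra.of ℚ G g + (j : ℚ) • b + e := by
      intro j
      induction j with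
      | zero => exact ⟨0, zero_mem _, by simp⟩
      | succ j ihj =>
        obtain ⟨e, he, hj⟩ := ihj
        refine ⟨(j : ℚ) • (autAlg θ b - b) + autAlg θ e,
          add_mem (Submodule.smul_mem _ _ (delta_mem θ hθ _ b ih)) (autAlg_mem_augI_pow θ _ e he), ?_⟩
        have : (θ ^ (j + 1)) g = θ ((θ ^ j) g) := by rw [pow_succ']; rfl
        rw [this, ← autAlg_of, hj, map_add, map_add, map_smul, autAlg_of]
        have : MonoidAlgebra.of ℚ G (θ g) = b + MonoidAlgebra.of ℚ G g := by rw [hb]; abel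
        rw [this]
        push_cast
        module
    obtain ⟨e, he, hk⟩ := key m
    rw [h] at hk
    have h0 : (m : ℚ) • b = -e := by
      have h5 : MonoidAlgebra.of ℚ G ((1 : MulAut G) g) = MonoidAlgebra.of ℚ G g := rfl
      rw [h5, add_assoc, left_eq_add] at hk
      exact eq_neg_of_add_eq_zero_left hk
    have hm0 : (m : ℚ) ≠ 0 := by positivity
    have : b = (m : ℚ)⁻¹ • (-e) := by rw [← h0, smul_smul, inv_mul_cancel₀ hm0, one_smul]
    rw [this]
    exact Submodule.smul_mem _ _ (neg_mem he)

/-! ### The quotient by the square -/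

lemma quot_span (n : ℕ) : 
    ∀ x : MonoidAlgebra ℚ (FreeGroup (Fin n)), x ∈ Submodule.span ℚ (Set.range
      (fun o : Option (Fin n) => o.elim (1 : MonoidAlgebra ℚ (FreeGroup (Fin n)))
        (fun i => MonoidAlgebra.of ℚ _ (FreeGroup.of i) - 1))) ⊔ augI (FreeGroup (Fin n)) ^ 2 := by
  set U := Submodule.span ℚ (Set.range
      (fun o : Option (Fin n) => o.elim (1 : MonoidAlgebra ℚ (FreeGroup (Fin n)))
        (fun i => MonoidAlgebra.of ℚ _ (FreeGroup.of i) - 1))) ⊔ augI (FreeGroup (Fin n)) ^ 2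
  have hsq : ∀ g h : FreeGroup (Fin n), (MonoidAlgebra.of ℚ _ g - 1) * (MonoidAlgebra.of ℚ _ h - 1)
      ∈ U := fun g h => Submodule.mem_sup_right (by
        rw [pow_two]
        exact Submodule.mul_mem_mul (of_sub_one_mem_augI g) (of_sub_one_mem_augI h))
  have h1 : (1 : MonoidAlgebra ℚ (FreeGroup (Fin n))) ∈ U :=
    Submodule.mem_sup_left (Submodule.subset_span ⟨none, rfl⟩)
  have hg : ∀ g : FreeGroup (Fin n), MonoidAlgebra.of ℚ _ g - 1 ∈ U := by
    intro g
    induction g using FreeGroup.induction_on with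
    | C1 => rw [map_one, sub_self]; exact zero_mem _
    | of i => exact Submodule.mem_sup_left (Submodule.subset_span ⟨some i, rfl⟩)
    | inv_of i hi =>
      have h2 := sub_mem (neg_mem hi) (hsq (FreeGroup.of i)⁻¹ (FreeGroup.of i))
      have h3 : MonoidAlgebra.of ℚ _ (FreeGroup.of i)⁻¹ * MonoidAlgebra.of ℚ _ (FreeGroup.of i) = 1 := by
        rw [← map_mul, inv_mul_cancel, map_one]
      convert h2 using 1
      simp only [sub_mul, mul_sub, h3, one_mul, mul_one]
      abel
    | mul g h hg hh =>
      have h2 := add_mem (add_mem hg hh) (hsq g h)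
      convert h2 using 1
      rw [map_mul]
      noncomm_ring
  intro x
  induction x using MonoidAlgebra.induction_on with
  | of g => have := add_mem (hg g) h1; rwa [sub_add_cancel] at this
  | add x y hx hy => exact add_mem hx hy
  | smul r x hx => exact Submodule.smul_mem _ _ hx

lemma quot_span_top (n : ℕ) : Submodule.span ℚ (Set.range
      (fun o : Option (Fin n) => (augI (FreeGroup (Fin n)) ^ 2).mkQ
        (o.elim (1 : MonoidAlgebra ℚ (FreeGroup (Fin n)))
        (fun i => MonoidAlgebra.of ℚ _ (FreeGroup.of i) - 1)))) = ⊤ := by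
  rw [eq_top_iff]
  rintro x -
  obtain ⟨x, rfl⟩ := Submodule.mkQ_surjective _ x
  obtain ⟨y, hy, z, hz, rfl⟩ := Submodule.mem_sup.1 (quot_span n x)
  have : (augI (FreeGroup (Fin n)) ^ 2).mkQ z = 0 := by simpa using hz
  rw [map_add, this, add_zero]
  have := Submodule.mem_map_of_mem (f := (augI (FreeGroup (Fin n)) ^ 2).mkQ) hy
  rw [Submodule.map_span, ← Set.range_comp] at this
  exact this

/-! ### The Magnus representation -/

/-- Left multiplication by the variable `i` on noncommutative power series. -/
def magX {α : Type*} [DecidableEq α] (i : α) : Module.End ℚ (List α → ℚ) where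
  toFun f l := match l with
    | [] => 0
    | a :: l => if a = i then f l else 0
  map_add' f g := by
    funext l; cases l <;> simp; split_ifs <;> simp
  map_smul' r f := by
    funext l; cases l <;> simp

def magInvFun {α : Type*} [DecidableEq α] (i : α) (f : List α → ℚ) : List α → ℚ
  | [] => f []
  | a :: l => f (a :: l) - if a = i then magInvFun i f l else 0

/-- Inverse of `1 + X i`. -/
def magInv {α : Type*} [DecidableEq α] (i : α) : Module.End ℚ (List α → ℚ) where
  toFun f := magInvFun i f
  map_add' f g := by
    funext l
    induction l with
    | nil => simp [magInvFun]
    | cons a l ih =>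
      simp only [magInvFun, Pi.add_apply] at ih ⊢
      rw [ih]; split_ifs <;> ring
  map_smul' r f := by
    funext l
    induction l with
    | nil => simp [magInvFun]
    | cons a l ih =>
      simp only [magInvFun, Pi.smul_apply, smul_eq_mul, RingHom.id_apply] at ih ⊢
      rw [ih]; split_ifs <;> ring

/-- The unit `1 + X i`. -/
def magU {α : Type*} [DecidableEq α] (i : α) : (Module.End ℚ (List α → ℚ))ˣ where
  val := 1 + magX i
  inv := magInv i
  val_inv := by
    ext f l
    cases l with
    | nil => simp [magX, magInv, magInvFun]
    | cons a l => simp [magX, magInv, magInvFun]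
  inv_val := by
    ext f l
    change magInvFun i (f + magX i f) l = f l
    induction l with
    | nil => simp [magX, magInvFun]
    | cons a l ih => 
      simp only [magInvFun, ih]
      simp [magX]

/-- The Magnus representation. -/
def mag (α : Type*) [DecidableEq α] : FreeGroup α →* (Module.End ℚ (List α → ℚ))ˣ :=
  FreeGroup.lift magU

/-- Operators raising the filtration by word length. -/
def raising (α : Type*) : Submodule ℚ (Module.End ℚ (List α → ℚ)) where
  carrier := {φ | ∀ k : ℕ, ∀ f : List α → ℚ, (∀ l, l.length < k → f l = 0) →
    ∀ l, l.length < k + 1 → φ f l = 0}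
  zero_mem' := by intro k f _ l _; rfl
  add_mem' := by
    intro φ ψ h1 h2 k f hf l hl
    simp [h1 k f hf l hl, h2 k f hf l hl]
  smul_mem' := by
    intro r φ h1 k f hf l hl
    simp [h1 k f hf l hl]

lemma raising_mul {α : Type*} {φ ψ} (h1 : φ ∈ raising α) (h2 : ψ ∈ raising α) :
    φ * ψ ∈ raising α := by
  intro k f hf l hl
  exact h1 (k + 1) (ψ f) (h2 k f hf) l (by omega)

lemma mag_sub_one_mem {α : Type*} [DecidableEq α] (g : FreeGroup α) :
    (mag α g : Module.End ℚ (List α → ℚ)) - 1 ∈ raising α := by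
  induction g using FreeGroup.induction_on with
  | C1 => simp
  | of i =>
    have : (mag α (FreeGroup.of i) : Module.End ℚ (List α → ℚ)) = 1 + magX i := by
      simp [mag, magU]
    rw [this, add_sub_cancel_left]
    intro k f hf l hl
    cases l with
    | nil => rfl
    | cons a l =>
      simp only [magX, LinearMap.coe_mk, AddHom.coe_mk]
      rw [hf l (by simpa using hl)]; simp
  | inv_of i _ =>
    have : (mag α (FreeGroup.of i)⁻¹ : Module.End ℚ (List α → ℚ)) = magInv i := by
      simp only [mag, map_inv, FreeGroup.lift_apply_of]; rfl
    rw [this]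
    intro k f hf l hl
    have hpres : ∀ l : List α, l.length < k → magInvFun i f l = 0 := by
      intro l
      induction l with
      | nil => intro h; exact hf _ h
      | cons a l ih =>
        intro h
        have h' : l.length < k := by simp at h; omega
        simp [magInvFun, hf _ h, ih h']
    change magInvFun i f l - f l = 0
    cases l with
    | nil => simp [magInvFun]
    | cons a l => simp [magInvFun, hpres l (by simpa using hl)]
  | mul g h hg hh =>
    have := add_mem (add_mem hg hh) (raising_mul hg hh)
    convert this using 1
    rw [map_mul, Units.val_mul]
    simp only [sub_mul, mul_sub, one_mul, mul_one]
    abel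

/-- The Magnus representation on the group algebra. -/
noncomputable def magAlg (α : Type*) [DecidableEq α] :
    MonoidAlgebra ℚ (FreeGroup α) →ₐ[ℚ] Module.End ℚ (List α → ℚ) :=
  MonoidAlgebra.lift ℚ _ _ ((Units.coeHom _).comp (mag α))

lemma magAlg_of {α : Type*} [DecidableEq α] (g : FreeGroup α) :
    magAlg α (MonoidAlgebra.of ℚ _ g) = (mag α g : Module.End ℚ (List α → ℚ)) := by
  simp [magAlg]

lemma magAlg_augI {α : Type*} [DecidableEq α] {x} (hx : x ∈ augI (FreeGroup α)) :
    magAlg α x ∈ raising α := by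
  have : augI (FreeGroup α) ≤ (raising α).comap (magAlg α).toLinearMap := by
    refine Submodule.span_le.2 ?_
    rintro _ ⟨g, rfl⟩
    have := mag_sub_one_mem g
    rw [← magAlg_of] at this
    simpa only [SetLike.mem_coe, Submodule.mem_comap, AlgHom.toLinearMap_apply, map_sub, map_one]
      using this
  exact this hx

lemma magAlg_augI_pow {α : Type*} [DecidableEq α] (k : ℕ) (x) (hx : x ∈ augI (FreeGroup α) ^ k)
    (f : List α → ℚ) : ∀ l, l.length < k → magAlg α x f l = 0 := by
  induction hx using Submodule.pow_induction_on_left' with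
  | algebraMap r => intro l hl; simp at hl
  | add x y i hx hy h1 h2 => intro l hl; simp [h1 l hl, h2 l hl]
  | mem_mul a ha i x hx ih =>
    rw [map_mul]
    exact magAlg_augI ha i _ ih

/-- The constant power series one. -/
def magOne (α : Type*) : List α → ℚ
  | [] => 1
  | _ :: _ => 0

lemma mag_zpow {α : Type*} [DecidableEq α] (i : α) (e : ℤ) (f : List α → ℚ) (a : α) (l : List α)
    (hl : (a :: l).IsChain (· ≠ ·)) :
    (mag α (FreeGroup.of i ^ e) : Module.End ℚ (List α → ℚ)) f (a :: l) =
      f (a :: l) + if a = i then e * f l else 0 := by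
  have hone : ∀ (f : List α → ℚ) (a : α) (l : List α),
      (mag α (FreeGroup.of i) : Module.End ℚ (List α → ℚ)) f (a :: l) =
      f (a :: l) + if a = i then f l else 0 := by
    intro f a l
    simp [mag, magU, magX]
  have honenil : ∀ (f : List α → ℚ),
      (mag α (FreeGroup.of i) : Module.End ℚ (List α → ℚ)) f [] = f [] := by
    intro f
    simp [mag, magU, magX]
  -- words not starting with `i`
  have hinv : ∀ (e : ℤ) (f : List α → ℚ) (l : List α), (∀ b ∈ l.head?, b ≠ i) →
      (mag α (FreeGroup.of i ^ e) : Module.End ℚ (List α → ℚ)) f l = f l := by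
    have hstep : ∀ (f : List α → ℚ) (l : List α), (∀ b ∈ l.head?, b ≠ i) →
      (mag α (FreeGroup.of i) : Module.End ℚ (List α → ℚ)) f l = f l := by
      intro f l hl
      cases l with
      | nil => exact honenil f
      | cons b l => rw [hone, if_neg (hl b (by simp)), add_zero]
    intro e
    induction e with
    | zero => intro f l _; simp
    | succ e ih =>
      intro f l hl
      rw [zpow_add_one, map_mul, Units.val_mul, Module.End.mul_apply, ih _ _ hl, hstep _ _ hl]
    | pred e ih =>
      intro f l hl
      have h1 := ih f l hl
      have h2 : FreeGroup.of i ^ (-(e : ℤ)) = FreeGroup.of i * FreeGroup.of i ^ (-(e : ℤ) - 1) := by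
        rw [← zpow_one_add]; congr 1; ring
      rw [h2, map_mul, Units.val_mul, Module.End.mul_apply, hstep _ _ hl] at h1
      exact h1
  by_cases hai : a = i
  · subst hai
    have hl' : ∀ b ∈ l.head?, b ≠ a := by
      intro b hb
      cases l with
      | nil => simp at hb
      | cons c l =>
        simp at hb
        subst hb
        simp at hl
        exact fun h => hl.1 h.symm
    simp only [if_true]
    induction e generalizing f with
    | zero => simp
    | succ e ih =>
      have h2 : FreeGroup.of a ^ ((e : ℤ) + 1) = FreeGroup.of a * FreeGroup.of a ^ (e : ℤ) := by
        rw [← zpow_one_add]; congr 1; ring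
      rw [h2, map_mul, Units.val_mul, Module.End.mul_apply, hone, if_pos rfl, ih, hinv _ _ _ hl']
      push_cast; ring
    | pred e ih =>
      have h1 := ih f
      have h2 : FreeGroup.of a ^ (-(e : ℤ)) = FreeGroup.of a * FreeGroup.of a ^ (-(e : ℤ) - 1) := by
        rw [← zpow_one_add]; congr 1; ring
      rw [h2, map_mul, Units.val_mul, Module.End.mul_apply, hone, if_pos rfl, hinv _ _ _ hl'] at h1
      push_cast at h1 ⊢
      linarith
  · rw [if_neg hai, add_zero]
    exact hinv e f _ (by simpa using hai)

/-- Product of syllables. -/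
def sylProd {α : Type*} (L : List (α × ℤ)) : FreeGroup α :=
  (L.map fun s => FreeGroup.of s.1 ^ s.2).prod

lemma mag_syl_zero {α : Type*} [DecidableEq α] (L : List (α × ℤ)) :
    ∀ l : List α, l.IsChain (· ≠ ·) → L.length < l.length →
      (mag α (sylProd L) : Module.End ℚ (List α → ℚ)) (magOne α) l = 0 := by
  induction L with
  | nil =>
    intro l _ hl
    cases l with
    | nil => simp at hl
    | cons a l => simp [sylProd, magOne]
  | cons s L ih =>
    intro l hc hl
    cases l with
    | nil => simp at hl
    | cons a l =>
      have : sylProd (s :: L) = FreeGroup.of s.1 ^ s.2 * sylProd L := by simp [sylProd]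
      simp only [List.length_cons] at hl
      rw [this, map_mul, Units.val_mul, Module.End.mul_apply, mag_zpow _ _ _ _ _ hc,
        ih _ hc (by simp; omega), ih l hc.tail (by omega)]
      simp

lemma mag_syl_prod {α : Type*} [DecidableEq α] (L : List (α × ℤ))
    (hc : (L.map Prod.fst).IsChain (· ≠ ·)) (h0 : ∀ s ∈ L, s.2 ≠ 0) :
      (mag α (sylProd L) : Module.End ℚ (List α → ℚ)) (magOne α) (L.map Prod.fst) ≠ 0 := by
  induction L with
  | nil => simp [sylProd, magOne]
  | cons s L ih =>
    have : sylProd (s :: L) = FreeGroup.of s.1 ^ s.2 * sylProd L := by simp [sylProd]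
    rw [List.map_cons] at hc ⊢
    rw [this, map_mul, Units.val_mul, Module.End.mul_apply, mag_zpow _ _ _ _ _ hc,
        mag_syl_zero L _ hc (by simp), if_pos rfl, zero_add]
    refine mul_ne_zero ?_ (ih hc.tail fun s hs => h0 s (by simp [hs]))
    exact_mod_cast h0 s (by simp)

lemma exists_syl {α : Type*} [DecidableEq α] (g : FreeGroup α) :
    ∃ L : List (α × ℤ), (L.map Prod.fst).IsChain (· ≠ ·) ∧ (∀ s ∈ L, s.2 ≠ 0) ∧ g = sylProd L := by
  have step : ∀ (i : α) (e : ℤ) (L : List (α × ℤ)), (L.map Prod.fst).IsChain (· ≠ ·) →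
      (∀ s ∈ L, s.2 ≠ 0) → ∃ L' : List (α × ℤ), (L'.map Prod.fst).IsChain (· ≠ ·) ∧
      (∀ s ∈ L', s.2 ≠ 0) ∧ FreeGroup.of i ^ e * sylProd L = sylProd L' := by
    intro i e L hc h0
    by_cases he : e = 0
    · exact ⟨L, hc, h0, by simp [he]⟩
    cases L with
    | nil => exact ⟨[(i, e)], by simp, by simpa using he, by simp [sylProd]⟩
    | cons s L =>
      obtain ⟨j, d⟩ := s
      by_cases hij : i = j
      · subst hij
        by_cases hed : e + d = 0
        · refine ⟨L, by rw [List.map_cons] at hc; exact hc.tail, fun s hs => h0 s (by simp [hs]), ?_⟩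
          simp [sylProd, ← mul_assoc, ← zpow_add, hed]
        · refine ⟨(i, e + d) :: L, by simpa using hc, ?_, ?_⟩
          · intro s hs
            rcases List.mem_cons.1 hs with rfl | hs
            · exact hed
            · exact h0 s (by simp [hs])
          · simp [sylProd, ← mul_assoc, ← zpow_add]
      · refine ⟨(i, e) :: (j, d) :: L, ?_, ?_, by simp [sylProd]⟩
        · rw [List.map_cons, List.map_cons, List.isChain_cons_cons]
          exact ⟨hij, by simpa using hc⟩
        · intro s hs
          rcases List.mem_cons.1 hs with rfl | hs
          · exact he
          · exact h0 s hs
  have main : ∀ (g : FreeGroup α) (L : List (α × ℤ)), (L.map Prod.fst).IsChain (· ≠ ·) →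
      (∀ s ∈ L, s.2 ≠ 0) → ∃ L' : List (α × ℤ), (L'.map Prod.fst).IsChain (· ≠ ·) ∧
      (∀ s ∈ L', s.2 ≠ 0) ∧ g * sylProd L = sylProd L' := by
    intro g
    induction g using FreeGroup.induction_on with
    | C1 => intro L h1 h2; exact ⟨L, h1, h2, one_mul _⟩
    | of i => intro L h1 h2; simpa using step i 1 L h1 h2
    | inv_of i _ => intro L h1 h2; simpa using step i (-1) L h1 h2
    | mul g h hg hh =>
      intro L h1 h2
      obtain ⟨L1, h3, h4, h5⟩ := hh L h1 h2
      obtain ⟨L2, h6, h7, h8⟩ := hg L1 h3 h4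
      exact ⟨L2, h6, h7, by rw [mul_assoc, h5, h8]⟩
  obtain ⟨L, h1, h2, h3⟩ := main g [] (by simp) (by simp)
  exact ⟨L, h1, h2, by simpa [sylProd] using h3⟩

lemma eq_one_of_mag {α : Type*} [DecidableEq α] (g : FreeGroup α)
    (h : (mag α g : Module.End ℚ (List α → ℚ)) (magOne α) = magOne α) : g = 1 := by
  obtain ⟨L, h1, h2, rfl⟩ := exists_syl g
  have h3 := mag_syl_prod L h1 h2
  rw [h] at h3
  cases L with
  | nil => simp [sylProd]
  | cons s L => simp [magOne] at h3

/-- Torsion automorphisms acting trivially on `I / I ^ 2` are trivial. -/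
lemma eq_one_of_trivial {α : Type*} [DecidableEq α] (θ : MulAut (FreeGroup α))
    (hθ : ∀ x ∈ augI (FreeGroup α), autAlg θ x - x ∈ augI (FreeGroup α) ^ 2)
    (m : ℕ) (hm : 1 ≤ m) (h : θ ^ m = 1) : θ = 1 := by
  ext1 g
  have hd := delta_of_mem θ hθ m hm h g
  have heq : (mag α (θ g) : Module.End ℚ (List α → ℚ)) = mag α g := by
    ext f l
    have := magAlg_augI_pow (l.length + 1) _ (hd l.length) (α := α)
    rw [map_sub, magAlg_of, magAlg_of] at this
    have := this f l (by omega)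
    simpa [sub_eq_zero] using this
  have heq' := Units.ext heq
  have : g⁻¹ * θ g = 1 := by
    apply eq_one_of_mag
    rw [map_mul, heq', ← map_mul, inv_mul_cancel]
    simp
  rw [inv_mul_eq_one] at this
  exact this.symm

/-- Every finite-order automorphism of the free group of rank `n ≥ 2` has order
dividing `(6n-6)!`. -/
theorem aut_freeGroup_order_dvd_factorial (n : ℕ) (hn : 2 ≤ n)
    (θ : MulAut (FreeGroup (Fin n))) (m : ℕ) (hm : 1 ≤ m) (h : θ ^ m = 1) :
    θ ^ (6 * n - 6).factorial = 1 := by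
  set J := augI (FreeGroup (Fin n)) ^ 2 with hJ
  have hfin : FiniteDimensional ℚ (MonoidAlgebra ℚ (FreeGroup (Fin n)) ⧸ J) :=
    ⟨⟨(Set.finite_range _).toFinset, by rw [Set.Finite.coe_toFinset]; exact quot_span_top n⟩⟩
  have hrank : Module.finrank ℚ (MonoidAlgebra ℚ (FreeGroup (Fin n)) ⧸ J) ≤ n + 1 := by
    have h1 := finrank_range_le_card (R := ℚ) (fun o : Option (Fin n) =>
        (augI (FreeGroup (Fin n)) ^ 2).mkQ
        (o.elim (1 : MonoidAlgebra ℚ (FreeGroup (Fin n)))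
        (fun i => MonoidAlgebra.of ℚ _ (FreeGroup.of i) - 1)))
    rw [Set.finrank, quot_span_top, finrank_top] at h1
    simpa using h1
  have hle : J ≤ J.comap (autAlg θ).toLinearMap := fun x hx => autAlg_mem_augI_pow θ 2 x hx
  set T : Module.End ℚ (MonoidAlgebra ℚ (FreeGroup (Fin n)) ⧸ J) :=
    J.mapQ J (autAlg θ).toLinearMap hle with hTdef
  have hpow : ∀ k x, (T ^ k) (J.mkQ x) = J.mkQ (autAlg (θ ^ k) x) := by
    intro k
    induction k with
    | zero =>
      intro x
      have := LinearMap.congr_fun (autAlg_one (G := FreeGroup (Fin n))) x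
      simp only [AlgHom.toLinearMap_apply] at this
      simp [this]
    | succ k ih =>
      intro x
      have := LinearMap.congr_fun (autAlg_mul (θ ^ k) θ) x
      simp only [AlgHom.toLinearMap_apply, Module.End.mul_apply] at this
      rw [pow_succ, pow_succ, this, ← ih]
      rfl
  have hTm : T ^ m = 1 := by
    refine LinearMap.ext fun x => ?_
    obtain ⟨x, rfl⟩ := J.mkQ_surjective x
    rw [hpow, h, ← pow_zero θ, ← hpow, pow_zero]
  have hTN := pow_factorial_eq_one T m (6 * n - 6) hm hTm (by omega)
  refine eq_one_of_trivial _ ?_ m hm (by rw [← pow_mul, mul_comm, pow_mul, h, one_pow])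
  intro x _
  have h1 := hpow (6 * n - 6).factorial x
  rw [hTN] at h1
  exact (Submodule.Quotient.eq J).1 h1.symm
end

section
/- Let n ≥ 2. Every finite-order element of the outer automorphism group Out(F_n) = Aut(FreeGroup (Fin n)) / Inn(FreeGroup (Fin n)) has order dividing (6n−6)!. -/
/-- The subgroup of inner automorphisms of a group `F`, i.e. the range of the
conjugation homomorphism `F →* MulAut F`. -/
def Inn (F : Type*) [Group F] : Subgroup (MulAut F) :=
  (MulAut.conj : F →* MulAut F).range

instance Inn.normal (F : Type*) [Group F] : (Inn F).Normal := by
  constructor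
  rintro _ ⟨g, rfl⟩ θ
  exact ⟨θ g, by ext x; simp [MulAut.conj]⟩

/-- The outer automorphism group `Out(F) = Aut(F) / Inn(F)`. -/
def Out (F : Type*) [Group F] : Type _ := MulAut F ⧸ Inn F

instance Out.group (F : Type*) [Group F] : Group (Out F) :=
  QuotientGroup.Quotient.group (Inn F)

namespace OutFn

theorem exists_fox {α S : Type*} [Ring S] (ρ : FreeGroup α →* S) (v : α → S) :
    ∃ D : FreeGroup α → S, (∀ i, D (FreeGroup.of i) = v i) ∧
      ∀ a b, D (a * b) = D a * ρ b + D b := by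
  let P : α → (Equiv.Perm S)ᵐᵒᵖ := fun i => MulOpposite.op
    { toFun := fun s => s * ρ (FreeGroup.of i) + v i
      invFun := fun s => (s - v i) * ρ (FreeGroup.of i)⁻¹
      left_inv := fun s => by
        simp only [add_sub_cancel_right, mul_assoc]
        rw [← map_mul, mul_inv_cancel, map_one, mul_one]
      right_inv := fun s => by
        simp only [mul_assoc]
        rw [← map_mul, inv_mul_cancel, map_one, mul_one, sub_add_cancel] }
  let f : FreeGroup α →* (Equiv.Perm S)ᵐᵒᵖ := FreeGroup.lift P
  have fmul : ∀ a b s, (f (a * b)).unop s = (f b).unop ((f a).unop s) := by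
    intro a b s
    rw [map_mul]; rfl
  have fof : ∀ i s, (f (FreeGroup.of i)).unop s = s * ρ (FreeGroup.of i) + v i := by
    intro i s
    have : f (FreeGroup.of i) = P i := FreeGroup.lift_apply_of
    rw [this]; rfl
  have key : ∀ a s, (f a).unop s = s * ρ a + (f a).unop 0 := by
    intro a
    induction a using FreeGroup.induction_on with
    | C1 => intro s; simp
    | of i => intro s; rw [fof, fof]; simp
    | inv_of i h =>
      intro s
      have e1 : ∀ s, (f (FreeGroup.of i)⁻¹).unop s = (s - v i) * ρ (FreeGroup.of i)⁻¹ := by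
        intro s
        have h2 := fmul (FreeGroup.of i)⁻¹ (FreeGroup.of i) s
        rw [inv_mul_cancel, fof] at h2
        simp only [map_one, MulOpposite.unop_one, Equiv.Perm.coe_one, id_eq] at h2
        have h3 : s - v i = (f (FreeGroup.of i)⁻¹).unop s * ρ (FreeGroup.of i) := by
          nth_rw 1 [h2]; simp
        rw [h3, mul_assoc, ← map_mul, mul_inv_cancel, map_one, mul_one]
      rw [e1, e1]; noncomm_ring
    | mul a b ha hb =>
      intro s
      rw [fmul, fmul, ha, hb, hb ((f a).unop 0), map_mul]; noncomm_ring
  refine ⟨fun a => (f a).unop 0, ?_, ?_⟩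
  · intro i; simp [fof]
  · intro a b; simp only []; rw [fmul, key b]

section Magnus
open MonoidAlgebra

variable {k : Type*} [Field k] {α : Type*}

/-- the augmentation -/
noncomputable def eps (k : Type*) [Field k] (G : Type*) [Group G] : MonoidAlgebra k G →ₐ[k] k :=
  MonoidAlgebra.lift k k G 1

theorem eps_of {G : Type*} [Group G] (g : G) : eps k G (of k G g) = 1 := by
  simp [eps]

/-- the augmentation ideal as a submodule -/
noncomputable def aug (k : Type*) [Field k] (G : Type*) [Group G] :
    Submodule k (MonoidAlgebra k G) := LinearMap.ker (eps k G).toLinearMap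

theorem mem_aug {G : Type*} [Group G] {a : MonoidAlgebra k G} : a ∈ aug k G ↔ eps k G a = 0 :=
  Iff.rfl

theorem mul_mem_augpow {G : Type*} [Group G] (m : ℕ) (s a : MonoidAlgebra k G)
    (ha : a ∈ aug k G ^ (m + 1)) : s * a ∈ aug k G ^ (m + 1) := by
  have h : (⊤ : Submodule k (MonoidAlgebra k G)) * aug k G ≤ aug k G := by
    rw [Submodule.mul_le]
    intro m _ n hn
    rw [mem_aug] at *
    rw [map_mul, hn, mul_zero]
  have : s * a ∈ (⊤ : Submodule k (MonoidAlgebra k G)) * aug k G ^ (m+1) :=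
    Submodule.mul_mem_mul trivial ha
  rw [pow_succ', ← mul_assoc] at this
  rw [pow_succ']
  exact mul_le_mul_left h _ this

theorem mul_mem_augpow_right {G : Type*} [Group G] (m : ℕ) (s a : MonoidAlgebra k G)
    (ha : a ∈ aug k G ^ (m + 1)) : a * s ∈ aug k G ^ (m + 1) := by
  have h : aug k G * (⊤ : Submodule k (MonoidAlgebra k G)) ≤ aug k G := by
    rw [Submodule.mul_le]
    intro m hn n _
    rw [mem_aug] at *
    rw [map_mul, hn, zero_mul]
  have : a * s ∈ aug k G ^ (m+1) * (⊤ : Submodule k (MonoidAlgebra k G)) :=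
    Submodule.mul_mem_mul ha trivial
  rw [pow_succ, mul_assoc] at this
  rw [pow_succ]
  exact mul_le_mul_right h _ this

theorem augpow_anti {G : Type*} [Group G] (m r : ℕ) :
    aug k G ^ (m + r + 1) ≤ aug k G ^ (m + 1) := by
  have : m + r + 1 = r + (m + 1) := by ring
  rw [this, pow_add, Submodule.mul_le]
  intro a _ b hb
  exact mul_mem_augpow _ _ _ hb

theorem of_sub_one_mem {G : Type*} [Group G] (g : G) : of k G g - 1 ∈ aug k G := by
  rw [mem_aug, map_sub, eps_of, map_one, sub_self]

theorem exists_lin {G : Type*} [Group G] (D : G → MonoidAlgebra k G)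
    (hD : ∀ a b, D (a * b) = D a * of k G b + D b) :
    ∃ E : MonoidAlgebra k G →ₗ[k] MonoidAlgebra k G,
      (∀ g, E (of k G g) = D g) ∧ ∀ a b, E (a * b) = E a * b + eps k G a • E b := by
  let E : MonoidAlgebra k G →ₗ[k] MonoidAlgebra k G :=
    (Finsupp.linearCombination k D) ∘ₗ (MonoidAlgebra.coeffLinearEquiv k).toLinearMap
  have hE : ∀ g, E (of k G g) = D g := by
    intro g
    simp [E, Finsupp.linearCombination_single]
  refine ⟨E, hE, ?_⟩
  intro a b
  induction a using MonoidAlgebra.induction_on with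
  | of g =>
    induction b using MonoidAlgebra.induction_on with
    | of h => rw [← map_mul, hE, hE, hE, hD, eps_of, one_smul]
    | add x y hx hy => rw [mul_add, map_add, hx, hy, map_add]; simp only [mul_add, smul_add]; abel
    | smul r x hx => rw [mul_smul_comm, map_smul, hx, map_smul, mul_smul_comm, smul_add, smul_comm r]
  | add x y hx hy => rw [add_mul, map_add, hx, hy, map_add, map_add]; simp only [add_mul, add_smul]; abel
  | smul r x hx => rw [smul_mul_assoc, map_smul, hx, map_smul, map_smul, smul_mul_assoc, smul_add, smul_assoc]

/-- span of the strict suffixes -/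
noncomputable def U (k : Type*) [Field k] : List (α × Bool) → Submodule k (MonoidAlgebra k (FreeGroup α))
  | [] => ⊥
  | _ :: L => Submodule.span k {of k (FreeGroup α) (FreeGroup.mk L)} ⊔ U k L

theorem mem_U_cons (l : α × Bool) (L : List (α × Bool)) :
    of k (FreeGroup α) (FreeGroup.mk L) ∈ U k (l :: L) :=
  Submodule.mem_sup_left (Submodule.mem_span_singleton_self _)

theorem U_le_cons (l : α × Bool) (L : List (α × Bool)) : U k L ≤ U k (l :: L) := le_sup_right

theorem mk_cons (l : α × Bool) (L : List (α × Bool)) :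
    FreeGroup.mk (l :: L) = FreeGroup.mk [l] * FreeGroup.mk L := by
  rw [FreeGroup.mul_mk]; rfl

theorem exists_D (l : α × Bool) : ∃ D : FreeGroup α → MonoidAlgebra k (FreeGroup α),
    (∀ a b, D (a * b) = D a * of k _ b + D b) ∧ D (FreeGroup.mk [l]) = 1 ∧
    D (FreeGroup.mk [(l.1, !l.2)]) = - of k _ (FreeGroup.mk [(l.1, !l.2)]) ∧
    ∀ l', l' ≠ l → l' ≠ (l.1, !l.2) → D (FreeGroup.mk [l']) = 0 := by
  classical
  obtain ⟨j, b⟩ := l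
  obtain ⟨D, h1, h2⟩ := exists_fox (of k (FreeGroup α)) (fun i => if i = j then
    (if b then 1 else -of k _ (FreeGroup.of j)) else 0)
  have D1 : D 1 = 0 := by
    have := h2 1 1
    rw [map_one] at this
    simpa using this
  have Dinv : ∀ a, D a⁻¹ = - (D a * of k _ a⁻¹) := by
    intro a
    have := h2 a a⁻¹
    rw [mul_inv_cancel, D1] at this
    rw [eq_neg_iff_add_eq_zero, add_comm]; exact this.symm
  have mt : ∀ i : α, FreeGroup.mk [(i, true)] = FreeGroup.of i := fun i => rfl
  have mf : ∀ i : α, FreeGroup.mk [(i, false)] = (FreeGroup.of i)⁻¹ := fun i => rfl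
  refine ⟨D, h2, ?_, ?_, ?_⟩
  · cases b
    · rw [mf, Dinv, h1]
      simp only [if_true, Bool.false_eq_true, if_false, neg_mul, neg_neg]
      rw [← map_mul, mul_inv_cancel, map_one]
    · rw [mt, h1]; simp
  · cases b
    · simp only [Bool.not_false, mt, h1]; simp
    · simp only [Bool.not_true, mf, Dinv, h1]; simp
  · rintro ⟨i, b'⟩ hne hne'
    have hij : i ≠ j := by
      rintro rfl
      cases b <;> cases b' <;> simp_all
    cases b'
    · rw [mf, Dinv, h1]; simp [hij]
    · rw [mt, h1]; simp [hij]

theorem magnus_aux (L : List (α × Bool)) (hL : FreeGroup.IsReduced L) (c : k)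
    (a : MonoidAlgebra k (FreeGroup α)) (ha : a ∈ U k L)
    (hJ : ∀ m, c • of k _ (FreeGroup.mk L) + a ∈ aug k (FreeGroup α) ^ (m + 1)) : c = 0 := by
  induction L generalizing c a with
  | nil =>
    have h0 := hJ 0
    have ha' : a = 0 := by simpa [U] using ha
    rw [ha', add_zero, zero_add, pow_one, mem_aug, map_smul, eps_of] at h0
    simpa using h0
  | cons l L ih =>
    obtain ⟨D, hD, D1, D2, D3⟩ := exists_D (k := k) l
    obtain ⟨E, hE, hE2⟩ := exists_lin D hD
    have D0 : D 1 = 0 := by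
      have := hD 1 1
      rw [map_one] at this
      simpa using this
    have fA : ∀ L : List (α × Bool), ∀ l', D (FreeGroup.mk L) ∈ U k (l' :: L) := by
      intro L
      induction L with
      | nil =>
        intro l'
        have : D 1 = 0 := D0
        have e : FreeGroup.mk ([] : List (α × Bool)) = 1 := rfl
        rw [e, this]; exact zero_mem _
      | cons lb L ihL =>
        intro l'
        rw [mk_cons, hD]
        refine add_mem ?_ (U_le_cons _ _ (ihL lb))
        by_cases h1 : lb = l
        · rw [h1, D1, one_mul]; exact U_le_cons _ _ (mem_U_cons _ _)
        by_cases h2 : lb = (l.1, !l.2)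
        · rw [h2, D2, neg_mul, ← map_mul, ← mk_cons]; exact neg_mem (mem_U_cons _ _)
        · rw [D3 _ h1 h2, zero_mul]; exact zero_mem _
    have fA' : D (FreeGroup.mk L) ∈ U k L := by
      cases L with
      | nil =>
        have : D 1 = 0 := D0
        have e : FreeGroup.mk ([] : List (α × Bool)) = 1 := rfl
        rw [e, this]; exact zero_mem _
      | cons lb L =>
        rw [mk_cons, hD]
        refine add_mem ?_ (fA _ _)
        by_cases h1 : lb = l
        · rw [h1, D1, one_mul]; exact mem_U_cons _ _
        have h2 : lb ≠ (l.1, !l.2) := by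
          rintro rfl
          have := (FreeGroup.isReduced_cons_cons.mp hL).1 rfl
          simp at this
        rw [D3 _ h1 h2, zero_mul]; exact zero_mem _
    have fB : ∀ L : List (α × Bool), ∀ a ∈ U k L, E a ∈ U k L := by
      intro L
      induction L with
      | nil => intro a ha; have : a = 0 := by simpa [U] using ha
               rw [this, map_zero]; exact zero_mem _
      | cons l' L ihL =>
        intro a ha
        obtain ⟨x, hx, y, hy, rfl⟩ := Submodule.mem_sup.mp ha
        obtain ⟨r, rfl⟩ := Submodule.mem_span_singleton.mp hx
        rw [map_add, map_smul, hE]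
        exact add_mem (Submodule.smul_mem _ _ (fA _ _)) (U_le_cons _ _ (ihL y hy))
    have fC : ∀ m, ∀ a ∈ aug k (FreeGroup α) ^ (m + 2), E a ∈ aug k (FreeGroup α) ^ (m + 1) := by
      intro m a ha
      rw [pow_succ'] at ha
      induction ha using Submodule.mul_induction_on' with
      | mem_mul_mem x hx y hy =>
        rw [hE2, mem_aug.mp hx, zero_smul, add_zero]
        exact mul_mem_augpow _ _ _ hy
      | add x _ y _ hx hy => rw [map_add]; exact add_mem hx hy
    obtain ⟨x, hx, y, hy, rfl⟩ := Submodule.mem_sup.mp ha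
    obtain ⟨r, rfl⟩ := Submodule.mem_span_singleton.mp hx
    refine ih (hL.infix (List.suffix_cons _ _).isInfix) c (c • D (FreeGroup.mk L) + (r • D (FreeGroup.mk L) + E y)) ?_ ?_
    · exact add_mem (Submodule.smul_mem _ _ fA') (add_mem (Submodule.smul_mem _ _ fA') (fB _ _ hy))
    · intro m
      have := fC m _ (hJ (m + 1))
      rw [map_add, map_smul, hE, map_add, map_smul, hE, mk_cons, hD, D1, one_mul, smul_add, add_assoc] at this
      exact this

theorem magnus (y : FreeGroup α) (hJ : ∀ m, of k _ y - 1 ∈ aug k (FreeGroup α) ^ (m + 1)) : y = 1 := by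
  classical
  by_contra hne
  have hw : y.toWord ≠ [] := by simpa [FreeGroup.toWord_eq_nil_iff] using hne
  have hmem : ∀ L : List (α × Bool), L ≠ [] → (-1 : MonoidAlgebra k (FreeGroup α)) ∈ U k L := by
    intro L
    induction L with
    | nil => simp
    | cons l L ih =>
      intro _
      by_cases h : L = []
      · subst h
        have := mem_U_cons (k := k) l []
        rw [show FreeGroup.mk ([] : List (α × Bool)) = 1 from rfl, map_one] at this
        exact neg_mem this
      · exact U_le_cons _ _ (ih h)
  refine one_ne_zero (magnus_aux (k := k) y.toWord FreeGroup.isReduced_toWord 1 (-1) (hmem _ hw) ?_)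
  intro m
  rw [FreeGroup.mk_toWord, one_smul, ← sub_eq_add_neg]; exact hJ m

end Magnus

/-- acts trivially on the abelianization -/
def IA {G : Type*} [Group G] (θ : MulAut G) : Prop :=
  ∀ x, Abelianization.of (θ x) = Abelianization.of x

section Pow
open MonoidAlgebra

theorem sub_mem_sq {k : Type*} [Field k] {G : Type*} [Group G] {x y : G}
    (h : Abelianization.of x = Abelianization.of y) :
    of k G x - of k G y ∈ aug k G ^ 2 := by
  let f : G →* Multiplicative (MonoidAlgebra k G ⧸ aug k G ^ 2) :=
    MonoidHom.mk' (fun g => Multiplicative.ofAdd (Submodule.Quotient.mk (of k G g - 1))) (by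
      intro a b
      rw [← ofAdd_add]
      congr 1
      rw [← Submodule.Quotient.mk_add, Submodule.Quotient.eq]
      have : of k G (a * b) - 1 - (of k G a - 1 + (of k G b - 1)) = (of k G a - 1) * (of k G b - 1) := by
        rw [map_mul]; noncomm_ring
      rw [this, pow_two]
      exact Submodule.mul_mem_mul (of_sub_one_mem _) (of_sub_one_mem _))
  have hf : f x = f y := by
    have := congrArg (Abelianization.lift f) h
    simpa using this
  have hf' : (Submodule.Quotient.mk (of k G x - 1) : MonoidAlgebra k G ⧸ aug k G ^ 2)
      = Submodule.Quotient.mk (of k G y - 1) := hf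
  rw [Submodule.Quotient.eq] at hf'
  simpa using hf'

theorem ia_pow_mem {q : ℕ} [Fact q.Prime] {G : Type*} [Group G] (θ : MulAut G) (hθ : IA θ)
    (e : ℕ) (x : G) :
    of (ZMod q) G ((θ ^ (q ^ e)) x * x⁻¹) - 1 ∈ aug (ZMod q) G ^ (q ^ e + 1) := by
  set k := ZMod q
  let Θ : MonoidAlgebra k G →ₐ[k] MonoidAlgebra k G := MonoidAlgebra.lift k _ G ((of k G).comp θ.toMonoidHom)
  have hΘ : ∀ g, Θ (of k G g) = of k G (θ g) := by intro g; simp [Θ]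
  let T : Module.End k (MonoidAlgebra k G) := Θ.toLinearMap
  let N := T - 1
  have hN : ∀ a, N a = Θ a - a := fun a => rfl
  have hI : ∀ a ∈ aug k G, N a ∈ aug k G ^ 2 := by
    have : ∀ a, N a ∈ aug k G ^ 2 := by
      intro a
      induction a using MonoidAlgebra.induction_on with
      | of g => rw [hN, hΘ]; exact sub_mem_sq (hθ g)
      | add x y hx hy => rw [map_add]; exact add_mem hx hy
      | smul r x hx => rw [map_smul]; exact Submodule.smul_mem _ _ hx
    exact fun a _ => this a
  have hΘI : ∀ m, ∀ a ∈ aug k G ^ (m + 1), N a ∈ aug k G ^ (m + 2) := by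
    intro m
    induction m with
    | zero => intro a ha; rw [zero_add, pow_one] at ha; exact hI a ha
    | succ m ih =>
      intro a ha
      rw [pow_succ] at ha
      induction ha using Submodule.mul_induction_on' with
      | mem_mul_mem x hx y hy =>
        have e1 : N (x * y) = N x * (y + N y) + x * N y := by
          simp only [hN, map_mul]; noncomm_ring
        rw [e1]
        refine add_mem ?_ ?_
        · rw [pow_succ]
          refine Submodule.mul_mem_mul (ih _ hx) (add_mem hy ?_)
          have := hI y hy
          have h2 := augpow_anti (k := k) (G := G) 0 1 this
          simpa using h2
        · have : m + 1 + 2 = (m + 1) + 2 := rfl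
          rw [pow_add]
          exact Submodule.mul_mem_mul hx (hI _ hy)
      | add x _ y _ hx hy => rw [map_add]; exact add_mem hx hy
  have hpow : ∀ r, ∀ a ∈ aug k G, (N ^ r) a ∈ aug k G ^ (r + 1) := by
    intro r
    induction r with
    | zero => intro a ha; simpa using ha
    | succ r ih => intro a ha; rw [pow_succ' N, Module.End.mul_apply]; exact hΘI _ _ (ih a ha)
  have : CharP (Module.End k (MonoidAlgebra k G)) q :=
    charP_of_injective_algebraMap (algebraMap k (Module.End k (MonoidAlgebra k G))).injective q
  have hfrob : N ^ (q ^ e) = T ^ (q ^ e) - 1 := by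
    have := sub_pow_char_pow_of_commute q e (Commute.one_right T)
    simpa using this
  have hT : ∀ r g, (T ^ r) (of k G g) = of k G ((θ ^ r) g) := by
    intro r
    induction r with
    | zero => intro g; simp
    | succ r ih => intro g; rw [pow_succ', pow_succ', Module.End.mul_apply, ih]; exact hΘ _
  have h1 := hpow (q ^ e) _ (of_sub_one_mem (k := k) x)
  rw [map_sub, hfrob] at h1
  have h1' : of k G ((θ ^ (q ^ e)) x) - of k G x ∈ aug k G ^ (q ^ e + 1) := by
    have e1 : (T ^ (q ^ e) - 1) (1 : MonoidAlgebra k G) = 0 := by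
      rw [← map_one (of k G), LinearMap.sub_apply, hT]; simp
    rw [e1, sub_zero, LinearMap.sub_apply, hT] at h1
    exact h1
  have := mul_mem_augpow_right _ (of k G x⁻¹) _ h1'
  rw [sub_mul, ← map_mul, ← map_mul, mul_inv_cancel, map_one] at this
  exact this

theorem ia_eq_one {q : ℕ} [Fact q.Prime] {α : Type*} (γ : MulAut (FreeGroup α))
    (h : ∀ e : ℕ, ∃ θ : MulAut (FreeGroup α), IA θ ∧ θ ^ (q ^ e) = γ) : γ = 1 := by
  ext1 x
  have : γ x * x⁻¹ = 1 := by
    apply magnus (k := ZMod q)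
    intro m
    obtain ⟨θ, h1, h2⟩ := h m
    have h3 := ia_pow_mem (q := q) θ h1 m x
    rw [h2] at h3
    have h4 : m ≤ q ^ m := (Nat.lt_pow_self (Fact.out : q.Prime).one_lt).le
    obtain ⟨r, hr⟩ := Nat.exists_eq_add_of_le h4
    rw [hr] at h3
    exact augpow_anti _ _ h3
  simpa using mul_inv_eq_one.mp this

end Pow
section Frob
open Polynomial

theorem trace_frob {R V : Type*} [Ring R] [AddCommGroup V] (q : ℕ) (hq : q.Prime)
    (hV : ∀ v : V, q • v = 0) (τ : R →+ V) (hτ : ∀ a b, τ (a * b) = τ (b * a)) (a b : R) :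
    τ ((a + b) ^ q) = τ (a ^ q) + τ (b ^ q) := by
  set P : R[X] := C a * X + C b with hP
  have hT : ∀ (i : ℕ) (f g : R[X]), τ ((f * g).coeff i) = τ ((g * f).coeff i) := by
    intro i f g
    rw [coeff_mul, coeff_mul, map_sum, map_sum, ← Finset.Nat.sum_antidiagonal_swap]
    refine Finset.sum_congr rfl fun x _ => ?_
    rw [hτ]; rfl
  have hder : ∀ m i j, τ ((derivative (P ^ m) * P ^ j).coeff i)
      = m • τ ((derivative P * P ^ (m - 1 + j)).coeff i) := by
    intro m i
    induction m with
    | zero => intro j; simp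
    | succ m ih =>
      intro j
      rw [pow_succ, derivative_mul, add_mul, coeff_add, map_add, mul_assoc, ← pow_succ', ih]
      have e1 : τ ((P ^ m * derivative P * P ^ j).coeff i) = τ ((derivative P * P ^ (m + j)).coeff i) := by
        rw [mul_assoc, hT, mul_assoc, ← pow_add, add_comm j m]
      rw [e1]
      cases m with
      | zero => simp
      | succ m =>
        have e2 : m + 1 - 1 + (j + 1) = m + 1 + j := by omega
        have e3 : m + 1 + 1 - 1 + j = m + 1 + j := by omega
        rw [e2, e3, ← succ_nsmul]
  have hmid : ∀ i, i + 1 < q → τ ((P ^ q).coeff (i + 1)) = 0 := by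
    intro i hi
    have h1 := hder q i 0
    rw [pow_zero, mul_one, hV, coeff_derivative] at h1
    have h2 : (i + 1) • τ ((P ^ q).coeff (i + 1)) = 0 := by
      rw [← map_nsmul, nsmul_eq_mul, (Nat.cast_commute (i+1) ((P ^ q).coeff (i + 1))).eq]
      simpa using h1
    have hc : Nat.Coprime (i + 1) q :=
      (Nat.coprime_of_lt_prime (by omega) hi hq).symm
    have h3 := addOrderOf_dvd_of_nsmul_eq_zero h2
    have h4 := addOrderOf_dvd_of_nsmul_eq_zero (hV (τ ((P ^ q).coeff (i + 1))))
    have h5 := Nat.dvd_gcd h3 h4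
    rw [hc.gcd_eq_one] at h5
    have h6 := Nat.dvd_one.mp h5
    exact AddMonoid.addOrderOf_eq_one_iff.mp h6
  have hdeg : P.natDegree ≤ 1 := natDegree_linear_le
  have hev : (a + b) ^ q = ∑ i ∈ Finset.range (q + 1), (P ^ q).coeff i := by
    have h1 : (P ^ q).natDegree < q + 1 := by
      have := natDegree_pow_le_of_le q hdeg
      omega
    have h2 := eval_eq_sum_range' h1 (1 : R)
    have h3 : eval 1 (P ^ q) = (a + b) ^ q := by
      have := map_pow (eval₂RingHom' (RingHom.id R) (1 : R) (fun a => Commute.one_right a)) P q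
      have e : eval 1 P = a + b := by simp [hP]
      rw [← e]; exact this
    rw [← h3, h2]; simp
  have hq2 := hq.two_le
  obtain ⟨s, rfl⟩ : ∃ s, q = s + 1 := ⟨q - 1, by omega⟩
  rw [hev, map_sum, Finset.sum_range_succ, Finset.sum_range_succ']
  have z : ∑ k ∈ Finset.range s, τ ((P ^ (s+1)).coeff (k + 1)) = 0 :=
    Finset.sum_eq_zero fun i hi => hmid i (by have := Finset.mem_range.mp hi; omega)
  have c0 : (P ^ (s+1)).coeff 0 = b ^ (s+1) := by
    have := map_pow (constantCoeff (R := R)) P (s+1)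
    simpa [hP] using this
  have c1 : (P ^ (s+1)).coeff (s+1) = a ^ (s+1) := by
    have := coeff_pow_of_natDegree_le (m := s + 1) hdeg
    rw [mul_one] at this
    rw [this]; simp [hP]
  rw [z, c0, c1, zero_add, add_comm]
end Frob

section Fox
variable {α S : Type*} [Ring S]

theorem fox_one (ρ : FreeGroup α →* S) (D : FreeGroup α → S)
    (hD : ∀ a b, D (a * b) = D a * ρ b + D b) : D 1 = 0 := by
  have := hD 1 1
  rw [map_one] at this
  simpa using this

theorem fox_inv (ρ : FreeGroup α →* S) (D : FreeGroup α → S)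
    (hD : ∀ a b, D (a * b) = D a * ρ b + D b) (a : FreeGroup α) : D a⁻¹ = - (D a * ρ a⁻¹) := by
  have := hD a a⁻¹
  rw [mul_inv_cancel, fox_one ρ D hD] at this
  rw [eq_neg_iff_add_eq_zero, add_comm]; exact this.symm

theorem fox_ext (ρ : FreeGroup α →* S) (D D' : FreeGroup α → S)
    (hD : ∀ a b, D (a * b) = D a * ρ b + D b) (hD' : ∀ a b, D' (a * b) = D' a * ρ b + D' b)
    (h : ∀ i, D (FreeGroup.of i) = D' (FreeGroup.of i)) (a : FreeGroup α) : D a = D' a := by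
  induction a using FreeGroup.induction_on with
  | C1 => rw [fox_one ρ D hD, fox_one ρ D' hD']
  | of i => exact h i
  | inv_of i h => rw [fox_inv ρ D hD, fox_inv ρ D' hD', h]
  | mul a b ha hb => rw [hD, hD', ha, hb]

variable [Fintype α] [DecidableEq α]

theorem trace_identity {V : Type*} [AddCommGroup V] (τ : S →+ V)
    (hτ : ∀ a b, τ (a * b) = τ (b * a)) (ρ : FreeGroup α →* S) (φ : MulAut (FreeGroup α)) (t : S)
    (ht : ∀ f, t * ρ f = ρ (φ f) * t) (D : α → FreeGroup α → S)
    (hD : ∀ j a b, D j (a * b) = D j a * ρ b + D j b)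
    (hDof : ∀ j i, D j (FreeGroup.of i) = if j = i then 1 else 0)
    (q : ℕ) (w : FreeGroup α) (hq : φ ^ q = MulAut.conj w * φ) (htq : t ^ q = ρ w * t)
    (B : Matrix α α S) (hB : ∀ j i, B j i = D j (φ (FreeGroup.of i)) * t) :
    τ (Matrix.trace (B ^ q)) - τ (t ^ q) = τ (Matrix.trace B) - τ t := by
  have chain : ∀ j a, D j (φ a) * t = ∑ i, D j (φ (FreeGroup.of i)) * t * D i a := by
    intro j
    refine fox_ext ρ _ _ ?_ ?_ ?_
    · intro a b
      rw [map_mul, hD, add_mul, mul_assoc, ← ht, mul_assoc]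
    · intro a b
      simp only [hD, mul_add, Finset.sum_add_distrib, Finset.sum_mul, mul_assoc]
    · intro i
      simp [hDof]
  have hpow : ∀ m j i, (B ^ m) j i = D j ((φ ^ m) (FreeGroup.of i)) * t ^ m := by
    intro m
    induction m with
    | zero => intro j i; simp [hDof, Matrix.one_apply]
    | succ m ih =>
      intro j i
      rw [pow_succ', Matrix.mul_apply]
      have : (φ ^ (m + 1)) (FreeGroup.of i) = φ ((φ ^ m) (FreeGroup.of i)) := by
        rw [pow_succ']; rfl
      rw [this, pow_succ', ← mul_assoc, chain, Finset.sum_mul]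
      refine Finset.sum_congr rfl fun l _ => ?_
      rw [ih, hB, mul_assoc]; simp only [mul_assoc]
  have fund : ∀ a, ∑ j, (ρ (FreeGroup.of j) - 1) * D j a = ρ a - 1 := by
    refine fox_ext ρ _ _ ?_ ?_ ?_
    · intro a b
      simp only [hD, mul_add, Finset.sum_add_distrib, Finset.sum_mul, mul_assoc]
    · intro a b
      rw [map_mul]; noncomm_ring
    · intro i
      simp [hDof]
  have hwt : ρ w⁻¹ * t ^ q = t := by
    rw [htq, ← mul_assoc, ← map_mul, inv_mul_cancel, map_one, one_mul]
  have hterm : ∀ i, (B ^ q) i i = B i i + (D i w * t * ρ (FreeGroup.of i) - D i w * t) := by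
    intro i
    rw [hpow, hq, hB]
    have : (MulAut.conj w * φ) (FreeGroup.of i) = w * φ (FreeGroup.of i) * w⁻¹ := rfl
    rw [this, hD, hD, fox_inv ρ _ (hD i), add_mul, neg_mul, mul_assoc _ _ (t ^ q), hwt,
      mul_assoc _ _ (t ^ q), hwt, add_mul, mul_assoc _ _ t, ← ht]
    noncomm_ring
  have h1 : τ (Matrix.trace (B ^ q)) = τ (Matrix.trace B) + (τ (t ^ q) - τ t) := by
    simp only [Matrix.trace, Matrix.diag]
    simp only [hterm, Finset.sum_add_distrib, map_add]
    congr 1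
    have h2 := congrArg (fun s => τ (s * t)) (fund w)
    simp only [Finset.sum_mul, map_sum] at h2
    rw [map_sum]
    rw [htq, ← map_sub]
    have : ρ w * t - t = (ρ w - 1) * t := by noncomm_ring
    rw [this, ← h2]
    refine Finset.sum_congr rfl fun i _ => ?_
    rw [map_sub, hτ, ← map_sub]; congr 1; noncomm_ring
  rw [h1]; abel
end Fox

section Classes
open MonoidAlgebra

/-- power map on conjugacy classes -/
def cpow {G : Type*} [Group G] (q : ℕ) : ConjClasses G → ConjClasses G :=
  Quotient.map (fun g => g ^ q) (fun _ _ h => IsConj.pow q h)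

theorem cpow_mk {G : Type*} [Group G] (q : ℕ) (g : G) :
    cpow q (ConjClasses.mk g) = ConjClasses.mk (g ^ q) := rfl

/-- universal trace -/
noncomputable def utr (k : Type*) [CommRing k] (G : Type*) [Group G] :
    MonoidAlgebra k G →+ (ConjClasses G →₀ k) :=
  (Finsupp.mapDomain.addMonoidHom ConjClasses.mk).comp coeffAddEquiv.toAddMonoidHom

theorem utr_single {k : Type*} [CommRing k] {G : Type*} [Group G] (g : G) (c : k) :
    utr k G (single g c) = Finsupp.single (ConjClasses.mk g) c := by
  simp [utr, Finsupp.mapDomain.addMonoidHom]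

theorem utr_comm {k : Type*} [CommRing k] {G : Type*} [Group G] (a b : MonoidAlgebra k G) :
    utr k G (a * b) = utr k G (b * a) := by
  induction a using MonoidAlgebra.induction_linear with
  | zero => simp
  | add x y hx hy => rw [add_mul, mul_add, map_add, map_add, hx, hy]
  | single g c =>
    induction b using MonoidAlgebra.induction_linear with
    | zero => simp
    | add x y hx hy => rw [add_mul, mul_add, map_add, map_add, hx, hy]
    | single h d =>
      rw [single_mul_single, single_mul_single, utr_single, utr_single, mul_comm c d]
      congr 1
      rw [ConjClasses.mk_eq_mk_iff_isConj, isConj_iff]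
      exact ⟨h, by group⟩

theorem frob_matrix {q : ℕ} [Fact q.Prime] {G α : Type*} [Group G] [Fintype α] [DecidableEq α]
    (X : Matrix α α (MonoidAlgebra (ZMod q) G)) :
    utr (ZMod q) G (Matrix.trace (X ^ q)) =
      Finsupp.mapDomain (cpow q) (utr (ZMod q) G (Matrix.trace X)) := by
  have hq : q.Prime := Fact.out
  have hadd : ∀ X Y : Matrix α α (MonoidAlgebra (ZMod q) G),
      utr (ZMod q) G (Matrix.trace ((X + Y) ^ q)) = utr (ZMod q) G (Matrix.trace (X ^ q))
        + utr (ZMod q) G (Matrix.trace (Y ^ q)) := by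
    refine trace_frob q hq ?_ ((utr (ZMod q) G).comp (Matrix.traceAddMonoidHom α _)) ?_
    · intro v; ext c; simp
    · intro A B
      simp only [AddMonoidHom.comp_apply, Matrix.traceAddMonoidHom_apply, Matrix.trace, Matrix.diag,
        Matrix.mul_apply, map_sum]
      rw [Finset.sum_comm]
      exact Finset.sum_congr rfl fun i _ => Finset.sum_congr rfl fun j _ => utr_comm _ _
  induction X using Matrix.induction_on' with
  | h_zero => simp [hq.ne_zero]
  | h_add A B hA hB =>
    rw [hadd, hA, hB, Matrix.trace_add, map_add, Finsupp.mapDomain_add]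
  | h_std_basis i j s =>
    induction s using MonoidAlgebra.induction_linear with
    | zero => simp [hq.ne_zero]
    | add x y hx hy =>
      rw [Matrix.single_add, hadd, hx, hy, Matrix.trace_add, map_add, Finsupp.mapDomain_add]
    | single g c =>
      by_cases hij : i = j
      · subst hij
        have hp : ∀ m : ℕ, (Matrix.single i i (single g c : MonoidAlgebra (ZMod q) G)) ^ (m + 1)
            = Matrix.single i i ((single g c) ^ (m + 1)) := by
          intro m
          induction m with
          | zero => simp
          | succ m ih => rw [pow_succ, ih, Matrix.single_mul_single_same, ← pow_succ]
        obtain ⟨m, hm⟩ : ∃ m, q = m + 1 := ⟨q - 1, by have := hq.pos; omega⟩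
        have hp' := hp m
        rw [← hm] at hp'
        rw [hp', Matrix.trace_single_eq_same, Matrix.trace_single_eq_same, single_pow, utr_single,
          utr_single, Finsupp.mapDomain_single, cpow_mk, ZMod.pow_card]
      · have h0 : (Matrix.single i j (single g c : MonoidAlgebra (ZMod q) G)) ^ q = 0 := by
          obtain ⟨m, hm⟩ : ∃ m, q = m + 2 := ⟨q - 2, by have := hq.two_le; omega⟩
          have hz : ∀ m : ℕ,
              (Matrix.single i j (single g c : MonoidAlgebra (ZMod q) G)) ^ (m + 2) = 0 := by
            intro m
            rw [pow_add, pow_two, Matrix.single_mul_single_of_ne, mul_zero]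
            exact fun h => hij h.symm
          have h := hz m
          rw [← hm] at h
          exact h
        rw [h0, Matrix.trace_single_eq_of_ne _ _ _ hij]; simp
end Classes

section Main
open MonoidAlgebra

theorem IA.one {G : Type*} [Group G] : IA (1 : MulAut G) := fun _ => rfl

theorem IA.mul {G : Type*} [Group G] {a b : MulAut G} (ha : IA a) (hb : IA b) : IA (a * b) :=
  fun x => (ha (b x)).trans (hb x)

theorem IA.inner {G : Type*} [Group G] (g : G) : IA (MulAut.conj g) := by
  intro x
  rw [MulAut.conj_apply, map_mul, map_mul, map_inv, mul_inv_cancel_comm]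

theorem IA.conj {G : Type*} [Group G] {a : MulAut G} (ha : IA a) (u : MulAut G) :
    IA (u * a * u⁻¹) := by
  intro x
  have h := congrArg (Abelianization.lift (Abelianization.of.comp u.toMonoidHom)) (ha (u⁻¹ x))
  rw [Abelianization.lift_apply_of, Abelianization.lift_apply_of] at h
  have e : u (u⁻¹ x) = x := MulAut.apply_inv_self _ _ _
  have h' : Abelianization.of (u (a (u⁻¹ x))) = Abelianization.of (u (u⁻¹ x)) := h
  rw [e] at h'
  exact h'

/-- An automorphism trivial on homology, with an inner power, is inner. -/
theorem inner_of_ia {n : ℕ} (hn : 2 ≤ n) (φ : MulAut (FreeGroup (Fin n))) (hφ : IA φ)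
    (m : ℕ) (hm : 1 ≤ m) (hinn : φ ^ m ∈ Inn (FreeGroup (Fin n))) :
    φ ∈ Inn (FreeGroup (Fin n)) := by
  classical
  set F := FreeGroup (Fin n) with hF
  have hfox := fun j : Fin n => exists_fox (of ℤ F) (fun i => if j = i then 1 else 0)
  choose D0 hD0of hD0 using hfox
  let cls : F → ConjClasses (MulAut F) := fun f => ConjClasses.mk (MulAut.conj f * φ)
  let push : MonoidAlgebra ℤ F →+ (ConjClasses (MulAut F) →₀ ℤ) :=
    (Finsupp.mapDomain.addMonoidHom cls).comp coeffAddEquiv.toAddMonoidHom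
  have push_single : ∀ f c, push (single f c) = Finsupp.single (cls f) c := by
    intro f c
    simp [push, Finsupp.mapDomain.addMonoidHom]
  let r0 : MonoidAlgebra ℤ F := ∑ i, D0 i (φ (FreeGroup.of i)) - 1
  let R := push r0
  have hR0 : R ≠ 0 := by
    let ε : MonoidAlgebra ℤ F →ₐ[ℤ] ℤ := MonoidAlgebra.lift ℤ ℤ F 1
    have hε : ∀ f, ε (of ℤ F f) = 1 := by intro f; simp [ε]
    let tot : (ConjClasses (MulAut F) →₀ ℤ) →+ ℤ := Finsupp.liftAddHom (fun _ => AddMonoidHom.id ℤ)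
    have htot : ∀ a, tot (push a) = ε a := by
      intro a
      induction a using MonoidAlgebra.induction_linear with
      | zero => simp
      | add x y hx hy => rw [map_add, map_add, map_add, hx, hy]
      | single f c => rw [push_single]; simp [tot, ε]
    have hd : ∀ i, ε (D0 i (φ (FreeGroup.of i))) = 1 := by
      intro i
      let f : F →* Multiplicative ℤ := MonoidHom.mk' (fun a => Multiplicative.ofAdd (ε (D0 i a))) (by
        intro a b
        rw [← ofAdd_add, hD0, map_add, map_mul, hε, mul_one])
      have h := congrArg (Abelianization.lift f) (hφ (FreeGroup.of i))
      rw [Abelianization.lift_apply_of, Abelianization.lift_apply_of] at h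
      have h' : ε (D0 i (φ (FreeGroup.of i))) = ε (D0 i (FreeGroup.of i)) := h
      rw [h', hD0of]; simp
    intro h0
    have h1 := htot r0
    have h2 : push r0 = 0 := h0
    rw [h2, map_zero, map_sub, map_sum, map_one, Finset.sum_congr rfl (fun i _ => hd i)] at h1
    simp at h1
    omega
  obtain ⟨C0, hC0⟩ : ∃ C, C ∈ R.support := by
    rw [← Finsupp.support_nonempty_iff] at hR0; exact hR0
  obtain ⟨q, hqp, hqgt, hqmod⟩ := Nat.exists_prime_gt_modEq_one (k := m)
    (∑ C ∈ R.support, (R C).natAbs) (by omega)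
  have : Fact q.Prime := ⟨hqp⟩
  obtain ⟨g, hg⟩ := hinn
  obtain ⟨s, hs⟩ : ∃ s, q = m * s + 1 := by
    have h1 : m ∣ q - 1 := (Nat.modEq_iff_dvd' hqp.one_le).mp hqmod.symm
    obtain ⟨s, hs⟩ := h1
    exact ⟨s, by have := hqp.one_le; omega⟩
  have hphiq : φ ^ q = MulAut.conj (g ^ s) * φ := by
    rw [hs, pow_succ, pow_mul, ← hg, map_pow]
  let k := ZMod q
  let S := MonoidAlgebra k (MulAut F)
  let ρ : F →* S := (of k (MulAut F)).comp MulAut.conj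
  let t : S := of k (MulAut F) φ
  let h : MonoidAlgebra ℤ F →ₐ[ℤ] S := MonoidAlgebra.lift ℤ S F ρ
  have hh : ∀ f, h (of ℤ F f) = ρ f := by intro f; simp [h]
  let D : Fin n → F → S := fun j a => h (D0 j a)
  let B : Matrix (Fin n) (Fin n) S := fun j i => D j (φ (FreeGroup.of i)) * t
  have htr := trace_identity (utr k (MulAut F)) utr_comm ρ φ t
    (by
      intro f
      change of k _ φ * of k _ (MulAut.conj f) = of k _ (MulAut.conj (φ f)) * of k _ φ
      rw [← map_mul, ← map_mul]
      congr 1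
      ext x
      simp)
    D
    (by intro j a b; change h _ = h _ * ρ b + h _; rw [hD0, map_add, map_mul, hh])
    (by intro j i; change h _ = _; rw [hD0of]; split_ifs <;> simp)
    q (g ^ s) hphiq
    (by
      change of k _ φ ^ q = of k _ (MulAut.conj (g ^ s)) * of k _ φ
      rw [← map_pow, hphiq, map_mul])
    B (fun _ _ => rfl)
  rw [frob_matrix] at htr
  -- reduction mod q
  let red : (ConjClasses (MulAut F) →₀ ℤ) →+ (ConjClasses (MulAut F) →₀ k) :=
    Finsupp.mapRange.addMonoidHom (Int.castAddHom k)
  have hred : ∀ a, utr k (MulAut F) (h a * t) = red (push a) := by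
    intro a
    induction a using MonoidAlgebra.induction_linear with
    | zero => simp
    | add x y hx hy => rw [map_add, add_mul, map_add, hx, hy, map_add, map_add]
    | single f c =>
      have e1 : h (single f c) * t = single (MulAut.conj f * φ) (c : k) := by
        have e2 : (single f c : MonoidAlgebra ℤ F) = c • of ℤ F f := by simp
        rw [e2, map_smul, hh]
        change (c • of k _ (MulAut.conj f)) * of k _ φ = _
        rw [smul_mul_assoc, ← map_mul]
        simp
      rw [e1, utr_single, push_single]
      simp [red, cls]
  have hr : red R = utr k (MulAut F) (Matrix.trace B) - utr k (MulAut F) t := by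
    have e1 : h r0 * t = Matrix.trace B - t := by
      change h (∑ i, D0 i (φ (FreeGroup.of i)) - 1) * t
        = (∑ i, h (D0 i (φ (FreeGroup.of i))) * t) - t
      rw [map_sub, map_sum, map_one, sub_mul, one_mul, Finset.sum_mul]
    rw [← map_sub, ← e1, hred]
  have htq : utr k (MulAut F) (t ^ q) = Finsupp.mapDomain (cpow q) (utr k (MulAut F) t) := by
    change utr k (MulAut F) (of k _ φ ^ q) = Finsupp.mapDomain (cpow q) (utr k (MulAut F) (of k _ φ))
    rw [← map_pow, of_apply, of_apply, utr_single, utr_single, Finsupp.mapDomain_single, cpow_mk]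
  have hfix : Finsupp.mapDomain (cpow q) (red R) = red R := by
    rw [htq] at htr
    rw [hr]
    have := map_sub (Finsupp.mapDomain.addMonoidHom (M := k) (cpow (G := MulAut F) q))
      (utr k (MulAut F) (Matrix.trace B)) (utr k (MulAut F) t)
    exact this.trans htr
  have hstep : ∀ C ∈ R.support, ∃ C' ∈ R.support, cpow q C' = C := by
    intro C hC
    have hne : (red R) C ≠ 0 := by
      have e1 : (red R) C = ((R C : ℤ) : k) := rfl
      rw [e1]
      intro h0
      have h1 := (ZMod.intCast_zmod_eq_zero_iff_dvd _ q).mp h0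
      have h2 : q ∣ (R C).natAbs := Int.natCast_dvd.mp h1
      have h3 : 0 < (R C).natAbs := Int.natAbs_pos.mpr (Finsupp.mem_support_iff.mp hC)
      have h4 := Nat.le_of_dvd h3 h2
      have h5 : (R C).natAbs ≤ ∑ C ∈ R.support, (R C).natAbs :=
        Finset.single_le_sum (f := fun C => (R C).natAbs) (fun _ _ => Nat.zero_le _) hC
      omega
    rw [← hfix] at hne
    have h1 := Finsupp.mapDomain_support (Finsupp.mem_support_iff.mpr hne)
    obtain ⟨C', h2, h3⟩ := Finset.mem_image.mp h1
    refine ⟨C', ?_, h3⟩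
    rw [Finsupp.mem_support_iff] at h2 ⊢
    intro h0
    apply h2
    have e1 : (red R) C' = ((R C' : ℤ) : k) := rfl
    rw [e1, h0, Int.cast_zero]
  have hcls : ∀ C ∈ R.support, ∃ f, cls f = C := by
    intro C hC
    have h1 : C ∈ Finset.image cls r0.coeff.support := Finsupp.mapDomain_support hC
    obtain ⟨f, _, h2⟩ := Finset.mem_image.mp h1
    exact ⟨f, h2⟩
  have hiter : ∀ e : ℕ, ∀ C ∈ R.support, ∃ C' ∈ R.support, cpow (q ^ e) C' = C := by
    intro e
    induction e with
    | zero =>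
      intro C hC
      refine ⟨C, hC, ?_⟩
      obtain ⟨x, rfl⟩ := ConjClasses.mk_surjective C
      rw [cpow_mk]; simp
    | succ e ih =>
      intro C hC
      obtain ⟨C1, h1, h2⟩ := hstep C hC
      obtain ⟨C2, h3, h4⟩ := ih C1 h1
      refine ⟨C2, h3, ?_⟩
      rw [← h2, ← h4]
      obtain ⟨x, rfl⟩ := ConjClasses.mk_surjective C2
      rw [cpow_mk, cpow_mk, cpow_mk, ← pow_mul, pow_succ]
  obtain ⟨f0, hf0⟩ := hcls C0 hC0
  have hone : MulAut.conj f0 * φ = 1 := by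
    refine ia_eq_one (q := q) _ ?_
    intro e
    obtain ⟨C', h1, h2⟩ := hiter e C0 hC0
    obtain ⟨f, hf⟩ := hcls C' h1
    rw [← hf, ← hf0] at h2
    have h3 : ConjClasses.mk ((MulAut.conj f * φ) ^ q ^ e) = ConjClasses.mk (MulAut.conj f0 * φ) := h2
    rw [ConjClasses.mk_eq_mk_iff_isConj, isConj_iff] at h3
    obtain ⟨u, hu⟩ := h3
    refine ⟨u * (MulAut.conj f * φ) * u⁻¹, ((IA.inner f).mul hφ).conj u, ?_⟩
    rw [conj_pow, hu]
  have : φ = (MulAut.conj f0)⁻¹ := by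
    rw [eq_inv_iff_mul_eq_one, mul_eq_one_comm]; exact hone
  rw [this]
  exact inv_mem ⟨f0, rfl⟩

end Main

section Mat
open Polynomial

theorem totient_le_of_orderOf {n : ℕ} (M : Matrix (Fin n) (Fin n) ℚ) (hM : 0 < orderOf M)
    (p : ℕ) (hp : p.Prime) (k : ℕ) (hk : p ^ (k + 1) ∣ orderOf M) :
    Nat.totient (p ^ (k + 1)) ≤ n := by
  set d := orderOf M with hd
  have hpd : p ∣ d := (dvd_pow_self p (Nat.succ_ne_zero k)).trans hk
  obtain ⟨d', hd'⟩ := hpd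
  have hd'pos : 0 < d' := Nat.pos_of_ne_zero (by rintro rfl; simp at hd'; omega)
  have hannih : aeval M (X ^ d - 1 : ℚ[X]) = 0 := by
    simp [hd, pow_orderOf_eq_one]
  have hmin : minpoly ℚ M ∣ X ^ d - 1 := minpoly.dvd ℚ M hannih
  have hsub : d'.divisors ⊆ d.divisors := Nat.divisors_subset_of_dvd hM.ne' ⟨p, by rw [hd', mul_comm]⟩
  have hprod : (X ^ d - 1 : ℚ[X]) = (∏ i ∈ d.divisors \ d'.divisors, cyclotomic i ℚ) * (X ^ d' - 1) := by
    rw [← prod_cyclotomic_eq_X_pow_sub_one hM, ← prod_cyclotomic_eq_X_pow_sub_one hd'pos,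
      Finset.prod_sdiff hsub]
  by_cases hco : ∀ e ∈ d.divisors \ d'.divisors, IsCoprime (minpoly ℚ M) (cyclotomic e ℚ)
  · exfalso
    have h1 : IsCoprime (minpoly ℚ M) (∏ i ∈ d.divisors \ d'.divisors, cyclotomic i ℚ) :=
      IsCoprime.prod_right hco
    rw [hprod] at hmin
    have h2 := h1.dvd_of_dvd_mul_left hmin
    have h3 : aeval M (X ^ d' - 1 : ℚ[X]) = 0 := by
      obtain ⟨c, hc⟩ := h2
      rw [hc, map_mul, minpoly.aeval, zero_mul]
    have h4 : M ^ d' = 1 := by simpa [sub_eq_zero] using h3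
    have h5 := Nat.le_of_dvd hd'pos (orderOf_dvd_of_pow_eq_one h4)
    rw [← hd, hd'] at h5
    have := hp.two_le
    nlinarith
  · push Not at hco
    obtain ⟨e, he, hnc⟩ := hco
    rw [Finset.mem_sdiff, Nat.mem_divisors, Nat.mem_divisors] at he
    obtain ⟨⟨hed, _⟩, hed'⟩ := he
    have hepos : 0 < e := Nat.pos_of_dvd_of_pos hed hM
    have hirr := cyclotomic.irreducible_rat hepos
    have hdvd : cyclotomic e ℚ ∣ minpoly ℚ M := by
      rcases hirr.isCoprime_or_dvd (minpoly ℚ M) with h | h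
      · exact absurd h.symm hnc
      · exact h
    have hintegral : IsIntegral ℚ M := Matrix.isIntegral M
    have hdeg : Nat.totient e ≤ n := by
      have h1 := natDegree_le_of_dvd (hdvd.trans (Matrix.minpoly_dvd_charpoly M))
        (Matrix.charpoly_monic M).ne_zero
      rw [natDegree_cyclotomic, Matrix.charpoly_natDegree_eq_dim, Fintype.card_fin] at h1
      exact h1
    have hpe : p ^ (k + 1) ∣ e := by
      by_contra hcon
      apply hed'
      refine ⟨?_, hd'pos.ne'⟩
      obtain ⟨c, hc⟩ := hed
      have hpc : p ∣ c := by
        by_contra hpc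
        apply hcon
        have hcop : Nat.Coprime (p ^ (k + 1)) c := ((Nat.Prime.coprime_iff_not_dvd hp).mpr hpc).pow_left _
        rw [hc] at hk
        exact hcop.dvd_of_dvd_mul_right hk
      obtain ⟨c', rfl⟩ := hpc
      refine ⟨c', ?_⟩
      have : p * d' = p * (e * c') := by rw [← hd', hc]; ring
      exact Nat.eq_of_mul_eq_mul_left hp.pos this
    exact (Nat.le_of_dvd (Nat.totient_pos.mpr hepos) (Nat.totient_dvd_of_dvd hpe)).trans hdeg

theorem matrix_pow_factorial {n : ℕ} (hn : 2 ≤ n) (A : Matrix (Fin n) (Fin n) ℤ) (m : ℕ)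
    (hm : 1 ≤ m) (h : A ^ m = 1) : A ^ (6 * n - 6).factorial = 1 := by
  let f : Matrix (Fin n) (Fin n) ℤ →+* Matrix (Fin n) (Fin n) ℚ := (Int.castRingHom ℚ).mapMatrix
  have hf : Function.Injective f := Matrix.map_injective Int.cast_injective
  set M := f A with hMdef
  have hM1 : M ^ m = 1 := by rw [hMdef, ← map_pow, h, map_one]
  have hpos : 0 < orderOf M := orderOf_pos_iff.mpr (isOfFinOrder_iff_pow_eq_one.mpr ⟨m, hm, hM1⟩)
  have hdvd : orderOf M ∣ (6 * n - 6).factorial := by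
    rw [Nat.dvd_iff_prime_pow_dvd_dvd]
    intro p k hp hk
    cases k with
    | zero => simp
    | succ k =>
      have h1 := totient_le_of_orderOf M hpos p hp k hk
      rw [Nat.totient_prime_pow_succ hp] at h1
      apply Nat.dvd_factorial (pow_pos hp.pos _)
      have h2 := hp.two_le
      obtain ⟨r, rfl⟩ : ∃ r, p = r + 2 := ⟨p - 2, by omega⟩
      have h3 : r + 2 - 1 = r + 1 := by omega
      rw [h3] at h1
      have h4 : (r + 2) ^ (k + 1) ≤ 2 * ((r + 2) ^ k * (r + 1)) := by
        rw [pow_succ]; nlinarith [Nat.zero_le ((r + 2) ^ k * r)]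
      omega
  apply hf
  rw [map_pow, map_one]
  exact orderOf_dvd_iff_pow_eq_one.mp hdvd
end Mat

section Ab
variable {n : ℕ}

/-- exponent sum -/
def expo (i : Fin n) : FreeGroup (Fin n) →* Multiplicative ℤ :=
  FreeGroup.lift fun j => Multiplicative.ofAdd (if i = j then 1 else 0)

theorem expo_of (i j : Fin n) : expo i (FreeGroup.of j) = Multiplicative.ofAdd (if i = j then (1 : ℤ) else 0) :=
  FreeGroup.lift_apply_of

theorem hom_eq {A : Type*} [CommGroup A] (f : FreeGroup (Fin n) →* A) (y : FreeGroup (Fin n)) :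
    f y = ∏ i, f (FreeGroup.of i) ^ (expo i y).toAdd := by
  let g : FreeGroup (Fin n) →* A := MonoidHom.mk' (fun y => ∏ i, f (FreeGroup.of i) ^ (expo i y).toAdd) (by
    intro a b
    simp only [map_mul, toAdd_mul, zpow_add, Finset.prod_mul_distrib])
  have : f = g := by
    ext j
    simp [g, expo_of]
  exact congrArg (fun h => h y) this

/-- action on homology -/
def hmat (θ : MulAut (FreeGroup (Fin n))) : Matrix (Fin n) (Fin n) ℤ :=
  fun i j => (expo i (θ (FreeGroup.of j))).toAdd

theorem hmat_mul (θ η : MulAut (FreeGroup (Fin n))) : hmat (θ * η) = hmat θ * hmat η := by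
  ext i j
  rw [Matrix.mul_apply]
  have := hom_eq ((expo i).comp θ.toMonoidHom) (η (FreeGroup.of j))
  have h2 := congrArg Multiplicative.toAdd this
  rw [toAdd_prod] at h2
  simp only [toAdd_zpow, smul_eq_mul] at h2
  refine Eq.trans ?_ (h2.trans (Finset.sum_congr rfl fun l _ => mul_comm _ _))
  rfl

theorem hmat_one : hmat (1 : MulAut (FreeGroup (Fin n))) = 1 := by
  ext i j
  simp [hmat, expo_of, Matrix.one_apply]

theorem hmat_pow (θ : MulAut (FreeGroup (Fin n))) (m : ℕ) : hmat (θ ^ m) = hmat θ ^ m := by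
  induction m with
  | zero => simp [hmat_one]
  | succ m ih => rw [pow_succ, pow_succ, hmat_mul, ih]

theorem hmat_conj (g : FreeGroup (Fin n)) : hmat (MulAut.conj g) = 1 := by
  ext i j
  simp only [hmat, MulAut.conj_apply, map_mul, map_inv, mul_inv_cancel_comm]
  simp [expo_of, Matrix.one_apply]

theorem ia_of_hmat (θ : MulAut (FreeGroup (Fin n))) (h : hmat θ = 1) : IA θ := by
  intro x
  have key : Abelianization.of.comp θ.toMonoidHom = (Abelianization.of : FreeGroup (Fin n) →* _) := by
    ext j
    change Abelianization.of (θ (FreeGroup.of j)) = _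
    rw [hom_eq Abelianization.of (θ (FreeGroup.of j))]
    have e : ∀ i, (expo i (θ (FreeGroup.of j))).toAdd = if i = j then 1 else 0 := by
      intro i
      have := congrFun (congrFun h i) j
      rw [Matrix.one_apply] at this
      exact this
    simp [e]
  exact congrArg (fun f => f x) key
end Ab
end OutFn

/-- Every finite-order element of `Out(F_n)` with `n ≥ 2` has order dividing `(6n-6)!`. -/
theorem out_freeGroup_order_dvd_factorial (n : ℕ) (hn : 2 ≤ n)
    (x : Out (FreeGroup (Fin n))) (m : ℕ) (hm : 1 ≤ m) (h : x ^ m = 1) :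
    x ^ (6 * n - 6).factorial = 1 := by
  obtain ⟨φ, hφ⟩ := QuotientGroup.mk_surjective (s := Inn (FreeGroup (Fin n))) x
  subst hφ
  have key : ∀ k : ℕ, ((QuotientGroup.mk φ : Out (FreeGroup (Fin n))) ^ k = 1) ↔
      φ ^ k ∈ Inn (FreeGroup (Fin n)) := fun k =>
    QuotientGroup.eq_one_iff (N := Inn (FreeGroup (Fin n))) (φ ^ k)
  have hinn := (key m).mp h
  refine (key _).mpr ?_
  have hM : OutFn.hmat φ ^ m = 1 := by
    obtain ⟨g, hg⟩ := hinn
    rw [← OutFn.hmat_pow, ← hg, OutFn.hmat_conj]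
  have hN := OutFn.matrix_pow_factorial hn _ m hm hM
  rw [← OutFn.hmat_pow] at hN
  refine OutFn.inner_of_ia hn _ (OutFn.ia_of_hmat _ hN) m hm ?_
  rw [← pow_mul, mul_comm, pow_mul]
  exact Subgroup.pow_mem _ hinn _
end
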